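/- arXiv:1201.0936 — 2 statements merged into one kernel-verified Lean document; each statement's English description precedes it below -/
import Mathlib

section
/- The group of ℂ-algebra automorphisms of A = ℂ[x,y,z]/(x³y + y³ + z²) is isomorphic, as a group, to ℂ*; an isomorphism is induced by sending t ∈ ℂ* to the diagonal automorphism x ↦ t⁴x, y ↦ t⁶y, z ↦ t⁹z. -/
open MvPolynomial

noncomputable section

/-- The ideal (x³y + y³ + z²) in ℂ[x,y,z]. -/
def Ie7 : Ideal (MvPolynomial (Fin 3) ℂ) :=
  Ideal.span {(X 0 ^ 3 * X 1 + X 1 ^ 3 + X 2 ^ 2 : MvPolynomial (Fin 3) ℂ)}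

/-- The coordinate ring A = ℂ[x,y,z]/(x³y + y³ + z²) of the Klein surface. -/
abbrev Ae7 : Type := MvPolynomial (Fin 3) ℂ ⧸ Ie7

namespace Derivation

variable {A : Type*} [CommRing A] [Algebra ℂ A]

/-- `D.HasDegree a n` says that `n` is the largest number with `D^n a ≠ 0`, i.e. `a` has degree
`n` with respect to the locally nilpotent derivation `D`. -/
def HasDegree (D : Derivation ℂ A A) (a : A) (n : ℕ) : Prop :=
  D^[n] a ≠ 0 ∧ D^[n + 1] a = 0

theorem iterate_map_add (D : Derivation ℂ A A) (n : ℕ) (a b : A) :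
    D^[n] (a + b) = D^[n] a + D^[n] b :=
  _root_.iterate_map_add D n a b

theorem iterate_zero_right (D : Derivation ℂ A A) (n : ℕ) : D^[n] 0 = 0 :=
  _root_.iterate_map_zero D n

theorem iterate_eq_zero_of_le (D : Derivation ℂ A A) {a : A} {m n : ℕ} (h : m ≤ n)
    (ha : D^[m] a = 0) : D^[n] a = 0 := by
  obtain ⟨k, rfl⟩ := Nat.exists_eq_add_of_le' h
  rw [Function.iterate_add_apply, ha, D.iterate_zero_right]

theorem iterate_mul_eq_zero (D : Derivation ℂ A A) (s : ℕ) :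
    ∀ (m n : ℕ) (a b : A), m + n ≤ s + 1 → D^[m] a = 0 → D^[n] b = 0 → D^[s] (a * b) = 0 := by
  induction s with
  | zero =>
    intro m n a b hmn ha hb
    rcases Nat.eq_zero_or_pos m with rfl | hm
    · simp_all
    · obtain rfl : n = 0 := by omega
      simp_all
  | succ s ih =>
    intro m n a b hmn ha hb
    rcases m with _ | m
    · rw [Function.iterate_zero_apply] at ha
      rw [ha, zero_mul, D.iterate_zero_right]
    rcases n with _ | n
    · rw [Function.iterate_zero_apply] at hb
      rw [hb, mul_zero, D.iterate_zero_right]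
    rw [Function.iterate_succ_apply, D.leibniz, D.iterate_map_add, smul_eq_mul, smul_eq_mul,
      ih (m + 1) n a (D b) (by omega) ha hb, ih (n + 1) m b (D a) (by omega) hb ha, add_zero]

theorem iterate_mul_eq_choose (D : Derivation ℂ A A) (s : ℕ) :
    ∀ (m n : ℕ) (a b : A), m + n = s → D^[m + 1] a = 0 → D^[n + 1] b = 0 →
      D^[s] (a * b) = (s.choose m : A) * (D^[m] a * D^[n] b) := by
  induction s with
  | zero =>
    intro m n a b hmn ha hb
    obtain rfl : m = 0 := by omega
    obtain rfl : n = 0 := by omega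
    simp
  | succ s ih =>
    intro m n a b hmn ha hb
    rw [Function.iterate_succ_apply, D.leibniz, D.iterate_map_add, smul_eq_mul, smul_eq_mul]
    rcases m with _ | m
    · obtain rfl : n = s + 1 := by omega
      rw [ih 0 s a (D b) (by omega) ha hb]
      have : D a = 0 := ha
      simp [this, D.iterate_zero_right]
    rcases n with _ | n
    · obtain rfl : m = s := by omega
      have : D b = 0 := hb
      rw [mul_comm b, ih m 0 (D a) b (by omega) ha hb]
      simp [this, D.iterate_zero_right]
    rw [ih (m + 1) n a (D b) (by omega) ha hb, mul_comm b,
      ih m (n + 1) (D a) b (by omega) ha hb, Nat.choose_succ_succ]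
    simp only [Function.iterate_succ_apply]
    push_cast
    ring

variable {D : Derivation ℂ A A}

theorem HasDegree.unique {a : A} {m n : ℕ} (hm : D.HasDegree a m) (hn : D.HasDegree a n) :
    m = n := by
  rcases lt_trichotomy m n with h | h | h
  · exact absurd (D.iterate_eq_zero_of_le h hm.2) hn.1
  · exact h
  · exact absurd (D.iterate_eq_zero_of_le h hn.2) hm.1

theorem HasDegree.of_apply {a : A} {n : ℕ} (h : D.HasDegree (D a) n) : D.HasDegree a (n + 1) := h

theorem HasDegree.apply {a : A} {n : ℕ} (h : D.HasDegree a n) (ha : D a ≠ 0) :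
    ∃ m, n = m + 1 ∧ D.HasDegree (D a) m := by
  rcases n with _ | n
  · exact absurd h.2 ha
  · exact ⟨n, rfl, h⟩

theorem hasDegree_zero {a : A} (ha : a ≠ 0) (h : D a = 0) : D.HasDegree a 0 := ⟨ha, h⟩

theorem exists_hasDegree (hD : ∀ a, ∃ n, D^[n] a = 0) {a : A} (ha : a ≠ 0) :
    ∃ n, D.HasDegree a n := by
  classical
  have hpos : Nat.find (hD a) ≠ 0 := fun h => ha (by simpa [h] using Nat.find_spec (hD a))
  obtain ⟨n, hn⟩ := Nat.exists_eq_succ_of_ne_zero hpos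
  exact ⟨n, Nat.find_min (hD a) (by omega), by simpa [hn] using Nat.find_spec (hD a)⟩

variable [IsDomain A]

theorem HasDegree.mul {a b : A} {m n : ℕ} (ha : D.HasDegree a m) (hb : D.HasDegree b n) :
    D.HasDegree (a * b) (m + n) := by
  have : CharZero A := charZero_of_injective_algebraMap (algebraMap ℂ A).injective
  refine ⟨?_, D.iterate_mul_eq_zero _ (m + 1) (n + 1) a b (by omega) ha.2 hb.2⟩
  rw [D.iterate_mul_eq_choose _ m n a b rfl ha.2 hb.2]
  exact mul_ne_zero (by exact_mod_cast (Nat.choose_pos (by omega)).ne')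
    (mul_ne_zero ha.1 hb.1)

theorem HasDegree.pow {a : A} {m : ℕ} (ha : D.HasDegree a m) (k : ℕ) :
    D.HasDegree (a ^ k) (k * m) := by
  induction k with
  | zero => simpa using hasDegree_zero (D := D) one_ne_zero D.map_one_eq_zero
  | succ k ih =>
    rw [pow_succ, add_mul, one_mul]
    exact ih.mul ha

/-- The kernel of a locally nilpotent derivation is factorially closed. -/
theorem apply_eq_zero_of_mul (hD : ∀ a, ∃ n, D^[n] a = 0) {a b : A} (hab : a * b ≠ 0)
    (h : D (a * b) = 0) : D a = 0 := by
  obtain ⟨m, hm⟩ := exists_hasDegree hD (left_ne_zero_of_mul hab)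
  obtain ⟨n, hn⟩ := exists_hasDegree hD (right_ne_zero_of_mul hab)
  have := (hm.mul hn).unique (hasDegree_zero hab h)
  obtain rfl : m = 0 := by omega
  exact hm.2

theorem apply_eq_zero_of_pow (hD : ∀ a, ∃ n, D^[n] a = 0) {a : A} (ha : a ≠ 0) (k : ℕ)
    (h : D (a ^ (k + 1)) = 0) : D a = 0 := by
  rw [pow_succ'] at h
  exact apply_eq_zero_of_mul hD (mul_ne_zero ha (pow_ne_zero k ha)) h

/-- If `u` has smaller degree than `w` then `D u` is no nonzero multiple of `w`. -/
theorem apply_eq_zero_of_degree_le (hD : ∀ a, ∃ n, D^[n] a = 0) {u w k q : A} (hk : k ≠ 0)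
    (hDk : D k = 0) (h : k * D u = w * q)
    (huw : ∀ m n, D.HasDegree u m → D.HasDegree w n → m ≤ n) : D u = 0 := by
  by_contra hu
  have hwq : w * q ≠ 0 := h ▸ mul_ne_zero hk hu
  obtain ⟨m, hm⟩ := exists_hasDegree hD hu
  obtain ⟨n, hn⟩ := exists_hasDegree hD (left_ne_zero_of_mul hwq)
  obtain ⟨l, hl⟩ := exists_hasDegree hD (right_ne_zero_of_mul hwq)
  have h1 := ((hasDegree_zero hk hDk).mul hm).unique (h ▸ hn.mul hl)
  have h2 := huw _ _ hm.of_apply hn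
  omega

theorem HasDegree.eq_of_apply_add_eq_zero {a b : A} {m n : ℕ} (ha : D.HasDegree a m)
    (hb : D.HasDegree b n) (h : D a + D b = 0) : m = n := by
  have key : D b = -1 * D a := by linear_combination h
  rcases m with _ | m
  · have hDa : D a = 0 := ha.2
    have hDb : D b = 0 := by rw [key, hDa, mul_zero]
    rcases n with _ | n
    · rfl
    · exact absurd (by rw [Function.iterate_succ_apply, hDb, D.iterate_zero_right]) hb.1
  · have h1 : D.HasDegree (D b) (0 + m) := by
      rw [key]
      exact (hasDegree_zero (by simp) (by simp)).mul ha
    have := hb.unique h1.of_apply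
    omega

/-- Solutions of `a u ^ 3 + b w ^ 2 = k` with `a`, `b`, `k` nonzero constants are constant. -/
theorem apply_eq_zero_of_cubic_add_sq (hD : ∀ a, ∃ n, D^[n] a = 0) {a b k u w : A}
    (ha : a ≠ 0) (hb : b ≠ 0) (hk : k ≠ 0) (hDa : D a = 0) (hDb : D b = 0) (hDk : D k = 0)
    (h : a * u ^ 3 + b * w ^ 2 = k) : D u = 0 ∧ D w = 0 := by
  have : CharZero A := charZero_of_injective_algebraMap (algebraMap ℂ A).injective
  have hd : D (a * u ^ 3) + D (b * w ^ 2) = 0 := by rw [← D.map_add, h, hDk]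
  have hd' : 3 * a * u ^ 2 * D u + 2 * b * w * D w = 0 := by
    simp only [D.leibniz, D.leibniz_pow, hDa, hDb, smul_eq_mul, nsmul_eq_mul] at hd
    push_cast at hd
    linear_combination hd
  have hu : D u = 0 := by
    refine apply_eq_zero_of_degree_le hD (k := (3 : ℕ) * k) (w := w)
      (q := b * (3 * w * D u - 2 * u * D w)) (mul_ne_zero (by norm_num) hk)
      (by rw [D.leibniz, hDk, D.map_natCast, smul_zero, smul_zero, add_zero]) ?_
      fun m n hm hn => ?_
    · rw [← h]
      push_cast
      linear_combination u * hd'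
    · have := ((hasDegree_zero ha hDa).mul (hm.pow 3)).eq_of_apply_add_eq_zero
        ((hasDegree_zero hb hDb).mul (hn.pow 2)) hd
      omega
  refine ⟨hu, ?_⟩
  have h0 : 2 * b * w * D w = 0 := by simpa [hu] using hd'
  by_cases hw : w = 0
  · simp [hw]
  · simpa [hb, hw] using h0

/-- Solutions of `u ^ 3 + k u + w ^ 2 = 0` with `k` a nonzero constant are constant. -/
theorem apply_eq_zero_of_cubic_add_linear (hD : ∀ a, ∃ n, D^[n] a = 0) {k u w : A}
    (hk : k ≠ 0) (hDk : D k = 0) (h : u ^ 3 + k * u + w ^ 2 = 0) : D u = 0 := by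
  have : CharZero A := charZero_of_injective_algebraMap (algebraMap ℂ A).injective
  have hd : (3 * u ^ 2 + k) * D u + 2 * w * D w = 0 := by
    have hd := congrArg D h
    simp only [D.map_add, D.leibniz, D.leibniz_pow, hDk, smul_eq_mul, nsmul_eq_mul,
      D.map_zero] at hd
    push_cast at hd
    linear_combination hd
  refine apply_eq_zero_of_degree_le hD (k := (2 : ℕ) * k ^ 2) (w := w)
    (q := 9 * u * w * D u - 2 * (2 * k + 3 * u ^ 2) * D w)
    (mul_ne_zero (by norm_num) (pow_ne_zero 2 hk))
    (by rw [D.leibniz, D.leibniz_pow, hDk, D.map_natCast]; simp) ?_ fun m n hm hn => ?_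
  · push_cast
    linear_combination (2 * k + 3 * u ^ 2) * hd - 9 * u * D u * h
  · rcases Nat.eq_zero_or_pos m with rfl | hm0
    · exact Nat.zero_le n
    have hprod : u * (u ^ 2 + k) = -1 * w ^ 2 := by linear_combination h
    have hw := (hasDegree_zero (D := D) (a := (-1 : A)) (by simp) (by simp)).mul (hn.pow 2)
    have hne : u * (u ^ 2 + k) ≠ 0 := fun h0 => hw.1 (by rw [← hprod, h0, D.iterate_zero_right])
    obtain ⟨l, hl⟩ := exists_hasDegree hD (right_ne_zero_of_mul hne)
    have h1 := hl.eq_of_apply_add_eq_zero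
      ((hasDegree_zero (D := D) (a := (-1 : A)) (by simp) (by simp)).mul (hm.pow 2))
      (by simp [hDk])
    have h2 := (hprod ▸ hm.mul hl).unique hw
    omega

end Derivation

/-- An `ℕ`-grading of a `ℂ`-algebra, encoded by the map `a ↦ ∑ a_d T^d`, where `a_d` is the
homogeneous component of `a` of degree `d`. -/
structure NatCoaction (A : Type*) [CommRing A] [Algebra ℂ A] where
  /-- The generating polynomial of the homogeneous components. -/
  hom : A →ₐ[ℂ] Polynomial A
  eval_one : ∀ a, (hom a).eval 1 = a
  hom_coeff : ∀ a d, hom ((hom a).coeff d) = Polynomial.monomial d ((hom a).coeff d)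

namespace NatCoaction

variable {A : Type*} [CommRing A] [Algebra ℂ A] (G : NatCoaction A)

/-- `a` is homogeneous of degree `d`. -/
def IsHom (d : ℕ) (a : A) : Prop := G.hom a = Polynomial.monomial d a

variable {G}

theorem IsHom.mul {d e : ℕ} {a b : A} (ha : G.IsHom d a) (hb : G.IsHom e b) :
    G.IsHom (d + e) (a * b) := by
  rw [IsHom, map_mul, ha, hb, Polynomial.monomial_mul_monomial]

theorem IsHom.add {d : ℕ} {a b : A} (ha : G.IsHom d a) (hb : G.IsHom d b) :
    G.IsHom d (a + b) := by
  rw [IsHom, map_add, ha, hb, map_add]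

theorem IsHom.smul {d : ℕ} {a : A} (c : ℂ) (ha : G.IsHom d a) : G.IsHom d (c • a) := by
  rw [IsHom, map_smul, ha, Polynomial.smul_monomial]

theorem isHom_one : G.IsHom 0 (1 : A) := by
  rw [IsHom, map_one, Polynomial.monomial_zero_one]

theorem isHom_zero (d : ℕ) : G.IsHom d (0 : A) := by
  rw [IsHom, map_zero, Polynomial.monomial_zero_right]

theorem IsHom.pow {d : ℕ} {a : A} (ha : G.IsHom d a) (n : ℕ) : G.IsHom (n * d) (a ^ n) := by
  induction n with
  | zero => simpa using isHom_one
  | succ n ih =>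
    rw [pow_succ, add_mul, one_mul]
    exact ih.mul ha

theorem isHom_coeff (a : A) (d : ℕ) : G.IsHom d ((G.hom a).coeff d) := G.hom_coeff a d

theorem IsHom.coeff_self {d : ℕ} {a : A} (ha : G.IsHom d a) : (G.hom a).coeff d = a := by
  rw [ha, Polynomial.coeff_monomial_same]

theorem IsHom.unique {d e : ℕ} {a : A} (ha : G.IsHom d a) (hb : G.IsHom e a) (h0 : a ≠ 0) :
    d = e := by
  by_contra hne
  have h1 := hb.coeff_self
  rw [ha, Polynomial.coeff_monomial_of_ne _ (Ne.symm hne)] at h1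
  exact h0 h1.symm

theorem sum_coeff (a : A) :
    ∑ d ∈ Finset.range ((G.hom a).natDegree + 1), (G.hom a).coeff d = a := by
  conv_rhs => rw [← G.eval_one a, Polynomial.eval_eq_sum_range]
  simp

theorem induction_isHom {P : A → Prop} (h0 : P 0) (hadd : ∀ a b, P a → P b → P (a + b))
    (hhom : ∀ d a, G.IsHom d a → P a) (a : A) : P a := by
  rw [← sum_coeff (G := G) a]
  exact Finset.sum_induction _ P hadd h0 fun d _ => hhom d _ (isHom_coeff a d)

variable (G)

/-- The Euler derivation, multiplication by `d` in degree `d`. -/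
def euler : Derivation ℂ A A :=
  Derivation.mk'
    { toFun := fun a => (Polynomial.derivative (G.hom a)).eval 1
      map_add' := fun a b => by simp
      map_smul' := fun c a => by simp }
    fun a b => by
      simp only [LinearMap.coe_mk, AddHom.coe_mk, map_mul, Polynomial.derivative_mul,
        Polynomial.eval_add, Polynomial.eval_mul, G.eval_one, smul_eq_mul]
      ring

variable {G}

theorem IsHom.euler {d : ℕ} {a : A} (ha : G.IsHom d a) : G.euler a = (d : ℂ) • a := by
  change (Polynomial.derivative (G.hom a)).eval 1 = _
  rw [ha, Polynomial.derivative_monomial, Polynomial.eval_monomial, one_pow, mul_one, mul_comm,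
    Algebra.smul_def, map_natCast]

theorem IsHom.euler_iterate {d : ℕ} {a : A} (ha : G.IsHom d a) (n : ℕ) :
    G.euler^[n] a = ((d : ℂ) ^ n) • a := by
  induction n with
  | zero => simp
  | succ n ih =>
    rw [Function.iterate_succ_apply', ih, Derivation.map_smul, ha.euler, smul_smul, pow_succ]

theorem coeff_euler (a : A) (d : ℕ) :
    (G.hom (G.euler a)).coeff d = (d : ℂ) • (G.hom a).coeff d := by
  induction a using induction_isHom (G := G) with
  | h0 => simp
  | hadd a b ha hb => simp [ha, hb]
  | hhom e a ha =>
    rw [ha.euler, map_smul, Polynomial.coeff_smul, ha, Polynomial.coeff_monomial]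
    split_ifs with h
    · rw [h]
    · simp

theorem exists_isHom_of_euler_eq_smul {a : A} (ha : a ≠ 0) {c : ℂ} (h : G.euler a = c • a) :
    ∃ d : ℕ, c = d ∧ G.IsHom d a := by
  have key : ∀ d : ℕ, (G.hom a).coeff d ≠ 0 → c = d := fun d hd => by
    have h1 := coeff_euler (G := G) a d
    rw [h, map_smul, Polynomial.coeff_smul, ← sub_eq_zero, ← sub_smul] at h1
    rcases smul_eq_zero.mp h1 with h2 | h2
    · exact sub_eq_zero.mp h2
    · exact absurd h2 hd
  have hne : G.hom a ≠ 0 := fun h0 => ha (by rw [← G.eval_one a, h0, Polynomial.eval_zero])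
  refine ⟨_, key _ (mt Polynomial.leadingCoeff_eq_zero.mp hne), ?_⟩
  have hmon : G.hom a = Polynomial.monomial (G.hom a).natDegree
      ((G.hom a).coeff (G.hom a).natDegree) := by
    ext d
    rw [Polynomial.coeff_monomial]
    split_ifs with hd
    · rw [hd]
    · by_contra h0
      have h1 := key _ h0
      rw [key _ (mt Polynomial.leadingCoeff_eq_zero.mp hne)] at h1
      exact hd (by exact_mod_cast h1)
  have := G.eval_one a
  rw [hmon, Polynomial.eval_monomial, one_pow, mul_one] at this
  exact hmon.trans (congrArg _ this)

variable (G)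

/-- The homogeneous component of degree `M` of a derivation, as a linear map. -/
def componentLinear (E : Derivation ℂ A A) (M : ℕ) : A →ₗ[ℂ] A where
  toFun a := (G.hom a).sum fun e b => (G.hom (E b)).coeff (e + M)
  map_add' a b := by
    rw [map_add]
    exact Polynomial.sum_add_index _ _ _ (by simp) (by simp)
  map_smul' c a := by
    rw [map_smul, Polynomial.sum_smul_index' _ _ _ (by simp), RingHom.id_apply,
      Polynomial.smul_sum]
    simp

variable {G} in
theorem IsHom.componentLinear {d : ℕ} {a : A} (ha : G.IsHom d a) (E : Derivation ℂ A A) (M : ℕ) :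
    G.componentLinear E M a = (G.hom (E a)).coeff (d + M) := by
  simp only [NatCoaction.componentLinear, LinearMap.coe_mk, AddHom.coe_mk]
  rw [ha, Polynomial.sum_monomial_index _ _ (by simp)]

/-- The homogeneous component of degree `M` of a derivation. -/
def component (E : Derivation ℂ A A) (M : ℕ) : Derivation ℂ A A :=
  Derivation.mk' (G.componentLinear E M) fun a b => by
    induction a using induction_isHom (G := G) with
    | h0 => simp
    | hadd a a' ha ha' =>
      simp only [add_mul, map_add, ha, ha', smul_eq_mul]
      ring
    | hhom d a ha =>
      induction b using induction_isHom (G := G) with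
      | h0 => simp
      | hadd b b' hb hb' =>
        simp only [mul_add, map_add, hb, hb', smul_eq_mul]
        ring
      | hhom e b hb =>
        rw [(ha.mul hb).componentLinear, ha.componentLinear, hb.componentLinear, E.leibniz,
          smul_eq_mul, smul_eq_mul, map_add, map_mul, map_mul, ha, hb, Polynomial.coeff_add,
          show d + e + M = (e + M) + d by ring, Polynomial.coeff_monomial_mul,
          show (e + M) + d = (d + M) + e by ring, Polynomial.coeff_monomial_mul,
          smul_eq_mul, smul_eq_mul]

variable {G}

theorem IsHom.component {d : ℕ} {a : A} (ha : G.IsHom d a) (E : Derivation ℂ A A) (M : ℕ) :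
    G.component E M a = (G.hom (E a)).coeff (d + M) :=
  ha.componentLinear E M

theorem IsHom.isHom_component {d : ℕ} {a : A} (ha : G.IsHom d a) (E : Derivation ℂ A A) (M : ℕ) :
    G.IsHom (d + M) (G.component E M a) := by
  rw [ha.component]
  exact isHom_coeff _ _

theorem IsHom.isHom_component_iterate {d : ℕ} {a : A} (ha : G.IsHom d a) (E : Derivation ℂ A A)
    (M n : ℕ) : G.IsHom (d + n * M) ((G.component E M)^[n] a) := by
  induction n with
  | zero => simpa using ha
  | succ n ih =>
    rw [Function.iterate_succ_apply', add_mul, one_mul, ← add_assoc]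
    exact ih.isHom_component E M

/-- If the components of degree above `M` vanish, a derivation raises degrees by at most `M`,
and on the top-degree part it acts as its component of degree `M`. -/
theorem coeff_apply_of_top {E : Derivation ℂ A A} {M : ℕ}
    (hM : ∀ k, M < k → G.component E k = 0) {a : A} {e : ℕ}
    (ha : ∀ j, e < j → (G.hom a).coeff j = 0) :
    (∀ j, e + M < j → (G.hom (E a)).coeff j = 0) ∧
      (G.hom (E a)).coeff (e + M) = G.component E M ((G.hom a).coeff e) := by
  have hcomp : ∀ d k, d ≤ k → (G.hom (E ((G.hom a).coeff d))).coeff k =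
      G.component E (k - d) ((G.hom a).coeff d) := fun d k hdk => by
    rw [(isHom_coeff a d).component, Nat.add_sub_cancel' hdk]
  have hsum : E a = ∑ d ∈ Finset.range (e + 1), E ((G.hom a).coeff d) := by
    conv_lhs => rw [← G.eval_one a, Polynomial.eval_eq_sum_range' (n := e + 1)
      (Nat.lt_succ_of_le (Polynomial.natDegree_le_iff_coeff_eq_zero.mpr ha))]
    simp
  refine ⟨fun j hj => ?_, ?_⟩
  · rw [hsum, map_sum, Polynomial.finsetSum_coeff]
    refine Finset.sum_eq_zero fun d hd => ?_
    rw [Finset.mem_range] at hd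
    rw [hcomp d j (by omega), hM _ (by omega), Derivation.zero_apply]
  · rw [hsum, map_sum, Polynomial.finsetSum_coeff, Finset.sum_range_succ,
      Finset.sum_eq_zero, zero_add, hcomp e _ (by omega), Nat.add_sub_cancel_left]
    intro d hd
    rw [Finset.mem_range] at hd
    rw [hcomp d _ (by omega), hM _ (by omega), Derivation.zero_apply]

theorem IsHom.coeff_iterate_of_top {E : Derivation ℂ A A} {M : ℕ}
    (hM : ∀ k, M < k → G.component E k = 0) {a : A} {e : ℕ} (ha : G.IsHom e a) (n : ℕ) :
    (∀ j, e + n * M < j → (G.hom (E^[n] a)).coeff j = 0) ∧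
      (G.hom (E^[n] a)).coeff (e + n * M) = (G.component E M)^[n] a := by
  induction n with
  | zero =>
    refine ⟨fun j hj => ?_, ?_⟩
    · rw [Function.iterate_zero_apply, ha, Polynomial.coeff_monomial_of_ne _ (by omega)]
    · simpa using ha.coeff_self
  | succ n ih =>
    have := coeff_apply_of_top hM ih.1
    rw [ih.2, add_assoc, ← Nat.succ_mul] at this
    simpa only [Function.iterate_succ_apply'] using this

/-- The top component of positive degree of a derivation with bounded orbits is locally
nilpotent. -/
theorem component_locallyNilpotent {E : Derivation ℂ A A} {M : ℕ} (hM0 : 0 < M)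
    (hM : ∀ k, M < k → G.component E k = 0)
    (hE : ∀ a, ∃ B, ∀ n, (G.hom (E^[n] a)).natDegree ≤ B) (a : A) :
    ∃ n, (G.component E M)^[n] a = 0 := by
  induction a using induction_isHom (G := G) with
  | h0 => exact ⟨0, rfl⟩
  | hadd a b ha hb =>
    obtain ⟨m, hm⟩ := ha
    obtain ⟨n, hn⟩ := hb
    refine ⟨max m n, ?_⟩
    rw [Derivation.iterate_map_add, Derivation.iterate_eq_zero_of_le _ (le_max_left m n) hm,
      Derivation.iterate_eq_zero_of_le _ (le_max_right m n) hn, add_zero]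
  | hhom e a ha =>
    obtain ⟨B, hB⟩ := hE a
    refine ⟨B + 1, ?_⟩
    rw [← (ha.coeff_iterate_of_top hM (B + 1)).2]
    refine Polynomial.coeff_eq_zero_of_natDegree_lt ((hB _).trans_lt ?_)
    have := Nat.le_mul_of_pos_right (B + 1) hM0
    omega

variable (G)

/-- The Euler derivation transported along an automorphism. -/
def conjEuler (φ : A ≃ₐ[ℂ] A) : Derivation ℂ A A :=
  Derivation.mk' (φ.toLinearMap ∘ₗ (G.euler : A →ₗ[ℂ] A) ∘ₗ φ.symm.toLinearMap) fun a b => by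
    simp

variable {G}

theorem conjEuler_apply (φ : A ≃ₐ[ℂ] A) (a : A) :
    G.conjEuler φ a = φ (G.euler (φ.symm a)) := rfl

theorem conjEuler_iterate (φ : A ≃ₐ[ℂ] A) (a : A) (n : ℕ) :
    (G.conjEuler φ)^[n] a = φ (G.euler^[n] (φ.symm a)) := by
  induction n with
  | zero => simp
  | succ n ih => simp [Function.iterate_succ_apply', ih, conjEuler_apply]

theorem exists_natDegree_conjEuler_iterate_le (φ : A ≃ₐ[ℂ] A) (a : A) :
    ∃ B, ∀ n, (G.hom ((G.conjEuler φ)^[n] a)).natDegree ≤ B := by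
  obtain ⟨b, rfl⟩ := φ.surjective a
  simp only [conjEuler_iterate, AlgEquiv.symm_apply_apply]
  induction b using induction_isHom (G := G) with
  | h0 => exact ⟨0, fun n => by simp⟩
  | hadd a b ha hb =>
    obtain ⟨B, hB⟩ := ha
    obtain ⟨C, hC⟩ := hb
    refine ⟨max B C, fun n => ?_⟩
    rw [Derivation.iterate_map_add, map_add, map_add]
    exact (Polynomial.natDegree_add_le _ _).trans (max_le_max (hB n) (hC n))
  | hhom e a ha =>
    refine ⟨(G.hom (φ a)).natDegree, fun n => ?_⟩
    rw [ha.euler_iterate, map_smul, map_smul]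
    exact Polynomial.natDegree_smul_le _ _

end NatCoaction

namespace E7

/-- The class of the first coordinate. -/
def x : Ae7 := Ideal.Quotient.mk Ie7 (X 0)

/-- The class of the second coordinate. -/
def y : Ae7 := Ideal.Quotient.mk Ie7 (X 1)

/-- The class of the third coordinate. -/
def z : Ae7 := Ideal.Quotient.mk Ie7 (X 2)

theorem relation : x ^ 3 * y + y ^ 3 + z ^ 2 = 0 := by
  have : Ideal.Quotient.mk Ie7 (X 0 ^ 3 * X 1 + X 1 ^ 3 + X 2 ^ 2) = 0 :=
    Ideal.Quotient.eq_zero_iff_mem.mpr (Ideal.subset_span rfl)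
  rw [map_add, map_add, map_mul, map_pow, map_pow, map_pow] at this
  exact this

section Lift

variable {B : Type*} [CommRing B] [Algebra ℂ B]

/-- A solution of the defining equation in `B` is the same as a homomorphism to `B`. -/
def lift (a b c : B) (h : a ^ 3 * b + b ^ 3 + c ^ 2 = 0) : Ae7 →ₐ[ℂ] B :=
  Ideal.Quotient.liftₐ Ie7 (aeval ![a, b, c]) fun p hp => by
    have hle : Ie7 ≤ RingHom.ker (aeval ![a, b, c] : MvPolynomial (Fin 3) ℂ →ₐ[ℂ] B) := by
      rw [Ie7, Ideal.span_le, Set.singleton_subset_iff]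
      simpa [RingHom.mem_ker] using h
    exact hle hp

variable {a b c : B} (h : a ^ 3 * b + b ^ 3 + c ^ 2 = 0)

@[simp]
theorem lift_x : lift a b c h x = a :=
  (Ideal.Quotient.lift_mk Ie7 _ _).trans (by simp)

@[simp]
theorem lift_y : lift a b c h y = b :=
  (Ideal.Quotient.lift_mk Ie7 _ _).trans (by simp)

@[simp]
theorem lift_z : lift a b c h z = c :=
  (Ideal.Quotient.lift_mk Ie7 _ _).trans (by simp)

end Lift

theorem monomial_induction {P : Ae7 → Prop} (hadd : ∀ a b, P a → P b → P (a + b))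
    (hmon : ∀ (r : ℂ) i j k, P (r • (x ^ i * y ^ j * z ^ k))) (a : Ae7) : P a := by
  obtain ⟨p, rfl⟩ := Ideal.Quotient.mk_surjective a
  induction p using MvPolynomial.induction_on' with
  | monomial u r =>
    have := hmon r (u 0) (u 1) (u 2)
    rw [MvPolynomial.monomial_eq, Finsupp.prod_fintype _ _ (by simp), Fin.prod_univ_three,
      ← MvPolynomial.smul_eq_C_mul]
    exact this
  | add p q hp hq =>
    rw [map_add]
    exact hadd _ _ hp hq

theorem adjoin_eq_top : Algebra.adjoin ℂ {x, y, z} = ⊤ := by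
  rw [eq_top_iff]
  rintro a -
  induction a using monomial_induction with
  | hadd a b ha hb => exact add_mem ha hb
  | hmon r i j k =>
    refine Subalgebra.smul_mem _ (mul_mem (mul_mem (pow_mem ?_ _) (pow_mem ?_ _))
      (pow_mem ?_ _)) r <;> exact Algebra.subset_adjoin (by simp)

theorem algHom_ext {B : Type*} [CommRing B] [Algebra ℂ B] {f g : Ae7 →ₐ[ℂ] B}
    (hx : f x = g x) (hy : f y = g y) (hz : f z = g z) : f = g :=
  AlgHom.ext_of_adjoin_eq_top adjoin_eq_top (by
    rintro a (rfl | rfl | rfl) <;> assumption)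

theorem derivation_eq_zero {D : Derivation ℂ Ae7 Ae7} (hx : D x = 0) (hy : D y = 0)
    (hz : D z = 0) : D = 0 :=
  Derivation.ext_of_adjoin_eq_top _ adjoin_eq_top (by
    rintro a (rfl | rfl | rfl) <;> assumption)

/-- The map `x ↦ x T⁴`, `y ↦ y T⁶`, `z ↦ z T⁹` defining the grading. -/
def weightHom : Ae7 →ₐ[ℂ] Polynomial Ae7 :=
  lift (Polynomial.monomial 4 x) (Polynomial.monomial 6 y) (Polynomial.monomial 9 z) (by
    simp only [Polynomial.monomial_pow, Polynomial.monomial_mul_monomial]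
    rw [← map_add, ← map_add, relation, map_zero])

theorem weightHom_smul_monomial (r : ℂ) (i j k : ℕ) :
    weightHom (r • (x ^ i * y ^ j * z ^ k)) =
      Polynomial.monomial (4 * i + 6 * j + 9 * k) (r • (x ^ i * y ^ j * z ^ k)) := by
  rw [map_smul, map_mul, map_mul, map_pow, map_pow, map_pow, ← Polynomial.smul_monomial]
  simp only [weightHom, lift_x, lift_y, lift_z, Polynomial.monomial_pow,
    Polynomial.monomial_mul_monomial]

/-- The grading with weights `4`, `6`, `9`. -/
def grading : NatCoaction Ae7 where
  hom := weightHom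
  eval_one a := by
    induction a using monomial_induction with
    | hadd a b ha hb => rw [map_add, Polynomial.eval_add, ha, hb]
    | hmon r i j k =>
      rw [weightHom_smul_monomial, Polynomial.eval_monomial, one_pow, mul_one]
  hom_coeff a d := by
    induction a using monomial_induction with
    | hadd a b ha hb => rw [map_add, Polynomial.coeff_add, map_add, ha, hb, map_add]
    | hmon r i j k =>
      rw [weightHom_smul_monomial, Polynomial.coeff_monomial]
      split_ifs with h
      · rw [weightHom_smul_monomial, h]
      · simp

theorem isHom_x : grading.IsHom 4 x := by
  simp [NatCoaction.IsHom, grading, weightHom]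

theorem isHom_y : grading.IsHom 6 y := by
  simp [NatCoaction.IsHom, grading, weightHom]

theorem isHom_z : grading.IsHom 9 z := by
  simp [NatCoaction.IsHom, grading, weightHom]

/-- The span of the normal-form monomials of weight `e`. -/
def piece (e : ℕ) : Submodule ℂ Ae7 :=
  Submodule.span ℂ {a | ∃ i j k, k ≤ 1 ∧ 4 * i + 6 * j + 9 * k = e ∧ a = x ^ i * y ^ j * z ^ k}

theorem monomial_mem_piece (k : ℕ) :
    ∀ i j e, 4 * i + 6 * j + 9 * k = e → x ^ i * y ^ j * z ^ k ∈ piece e := by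
  induction k using Nat.strong_induction_on with
  | _ k ih =>
    intro i j e he
    rcases k with _ | _ | k
    · exact Submodule.subset_span ⟨i, j, 0, by omega, he, rfl⟩
    · exact Submodule.subset_span ⟨i, j, 1, by omega, he, rfl⟩
    · have : x ^ i * y ^ j * z ^ (k + 1 + 1) =
          -(x ^ (i + 3) * y ^ (j + 1) * z ^ k) - x ^ i * y ^ (j + 3) * z ^ k := by
        linear_combination x ^ i * y ^ j * z ^ k * relation
      rw [this]
      exact sub_mem (neg_mem (ih k (by omega) _ _ e (by omega))) (ih k (by omega) _ _ e (by omega))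

theorem coeff_mem_piece (a : Ae7) (e : ℕ) : (grading.hom a).coeff e ∈ piece e := by
  induction a using monomial_induction with
  | hadd a b ha hb =>
    rw [map_add, Polynomial.coeff_add]
    exact add_mem ha hb
  | hmon r i j k =>
    rw [show grading.hom = weightHom from rfl, weightHom_smul_monomial, Polynomial.coeff_monomial]
    split_ifs with h
    · exact (piece e).smul_mem r (monomial_mem_piece k i j e h)
    · exact zero_mem _

theorem mem_piece {a : Ae7} {e : ℕ} (ha : grading.IsHom e a) : a ∈ piece e := by
  rw [← ha.coeff_self]
  exact coeff_mem_piece a e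

theorem exists_eq_smul_of_mem_piece {e : ℕ} (i j k : ℕ)
    (h : ∀ i' j' k', k' ≤ 1 → 4 * i' + 6 * j' + 9 * k' = e → i' = i ∧ j' = j ∧ k' = k) {a : Ae7}
    (ha : a ∈ piece e) : ∃ r : ℂ, a = r • (x ^ i * y ^ j * z ^ k) := by
  have hle : piece e ≤ Submodule.span ℂ {x ^ i * y ^ j * z ^ k} := by
    refine Submodule.span_mono ?_
    rintro _ ⟨i', j', k', hk, he, rfl⟩
    obtain ⟨rfl, rfl, rfl⟩ := h i' j' k' hk he
    rfl
  obtain ⟨r, hr⟩ := Submodule.mem_span_singleton.mp (hle ha)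
  exact ⟨r, hr.symm⟩

theorem eq_zero_of_mem_piece {e : ℕ}
    (h : ∀ i j k, k ≤ 1 → 4 * i + 6 * j + 9 * k ≠ e) {a : Ae7} (ha : a ∈ piece e) : a = 0 := by
  have hle : piece e ≤ ⊥ := by
    refine Submodule.span_le.mpr ?_
    rintro _ ⟨i, j, k, hk, he, rfl⟩
    exact absurd he (h i j k hk)
  exact (Submodule.mem_bot ℂ).mp (hle ha)

theorem irreducible_equation :
    Irreducible (X 0 ^ 3 * X 1 + X 1 ^ 3 + X 2 ^ 2 : MvPolynomial (Fin 3) ℂ) := by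
  let e : MvPolynomial (Fin 3) ℂ ≃ₐ[ℂ] Polynomial (MvPolynomial (Fin 2) ℂ) :=
    (renameEquiv ℂ (Equiv.swap (0 : Fin 3) 2)).trans (finSuccEquiv ℂ 2)
  rw [← MulEquiv.irreducible_iff e]
  have he : e (X 0 ^ 3 * X 1 + X 1 ^ 3 + X 2 ^ 2) =
      Polynomial.X ^ 2 + Polynomial.C (X 1 ^ 3 * X 0 + X 0 ^ 3) := by
    have h0 : e (X 0) = Polynomial.C (X 1) := by
      simp only [e, AlgEquiv.trans_apply, renameEquiv_apply, rename_X, Equiv.swap_apply_left]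
      exact finSuccEquiv_X_succ (j := 1)
    have h1 : e (X 1) = Polynomial.C (X 0) := by
      simp only [e, AlgEquiv.trans_apply, renameEquiv_apply, rename_X]
      rw [Equiv.swap_apply_of_ne_of_ne (by decide) (by decide)]
      exact finSuccEquiv_X_succ (j := 0)
    have h2 : e (X 2) = Polynomial.X := by
      simp only [e, AlgEquiv.trans_apply, renameEquiv_apply, rename_X, Equiv.swap_apply_right]
      exact finSuccEquiv_X_zero
    simp only [map_add, map_mul, map_pow, h0, h1, h2]
    ring
  rw [he]
  have hmonic : (Polynomial.X ^ 2 + Polynomial.C (X 1 ^ 3 * X 0 + X 0 ^ 3) :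
      Polynomial (MvPolynomial (Fin 2) ℂ)).Monic := Polynomial.monic_X_pow_add_C _ two_ne_zero
  have hdeg : (Polynomial.X ^ 2 + Polynomial.C (X 1 ^ 3 * X 0 + X 0 ^ 3) :
      Polynomial (MvPolynomial (Fin 2) ℂ)).degree = 2 := Polynomial.degree_X_pow_add_C two_pos _
  have hprime : (Ideal.span {(X 0 : MvPolynomial (Fin 2) ℂ)}).IsPrime :=
    (Ideal.span_singleton_prime (X_ne_zero 0)).mpr X_prime
  refine Polynomial.irreducible_of_eisenstein_criterion hprime ?_ ?_ ?_ ?_ hmonic.isPrimitive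
  · rw [hmonic.leadingCoeff]
    exact (Ideal.ne_top_iff_one _).mp hprime.ne_top
  · intro n hn
    rw [hdeg] at hn
    have hn2 : n < 2 := by exact_mod_cast hn
    interval_cases n
    · simp only [Polynomial.coeff_add, Polynomial.coeff_X_pow, Polynomial.coeff_C_zero,
        Ideal.mem_span_singleton]
      exact ⟨X 1 ^ 3 + X 0 ^ 2, by simp; ring⟩
    · rw [Polynomial.coeff_add, Polynomial.coeff_X_pow, Polynomial.coeff_C_of_ne_zero one_ne_zero]
      simp
  · rw [hdeg]
    exact two_pos
  · simp only [Polynomial.coeff_add, Polynomial.coeff_X_pow, Polynomial.coeff_C_zero,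
      Ideal.span_singleton_pow, Ideal.mem_span_singleton]
    rintro ⟨q, hq⟩
    have hq' : (X 0 : MvPolynomial (Fin 2) ℂ) * (X 1 ^ 3 + X 0 ^ 2) = X 0 * (X 0 * q) := by
      simp at hq
      linear_combination hq
    have := congrArg (eval ![(0 : ℂ), 1]) (mul_left_cancel₀ (X_ne_zero 0) hq')
    simp at this

instance : IsDomain Ae7 := by
  have : Ie7.IsPrime := by
    rw [Ie7, Ideal.span_singleton_prime irreducible_equation.ne_zero]
    exact irreducible_equation.prime
  exact Ideal.Quotient.isDomain Ie7

theorem smul_x_cube_add_smul_y_sq {a b : ℂ} (h : a • x ^ 3 + b • y ^ 2 = 0) : a = 0 ∧ b = 0 := by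
  have h1 := congrArg (lift (1 : ℂ) 0 0 (by simp)) h
  have h2 := congrArg (lift (0 : ℂ) 1 Complex.I (by simp)) h
  constructor
  · simpa using h1
  · simpa using h2

theorem x_ne_zero : x ≠ 0 := fun h => by
  simpa using congrArg (lift (1 : ℂ) 0 0 (by simp)) h

theorem y_ne_zero : y ≠ 0 := fun h => by
  simpa using congrArg (lift (0 : ℂ) 1 Complex.I (by simp)) h

theorem z_ne_zero : z ≠ 0 := fun h => by
  simpa using congrArg (lift (0 : ℂ) 1 Complex.I (by simp)) h

/-- The binary form of degree `d` in `x³`, `y²` with the coefficients of `P`. -/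
def form (d : ℕ) (P : Polynomial ℂ) : Ae7 :=
  ∑ i ∈ Finset.range (d + 1), P.coeff i • ((x ^ 3) ^ i * (y ^ 2) ^ (d - i))

theorem form_succ_of_coeff_eq_zero {d : ℕ} {P : Polynomial ℂ} (hP : P.coeff (d + 1) = 0) :
    form (d + 1) P = y ^ 2 * form d P := by
  rw [form, Finset.sum_range_succ, hP, zero_smul, add_zero, form, Finset.mul_sum]
  refine Finset.sum_congr rfl fun i hi => ?_
  rw [Finset.mem_range] at hi
  rw [show d + 1 - i = (d - i) + 1 by omega, pow_succ, mul_smul_comm]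
  congr 1
  ring

theorem form_succ_X_mul (d : ℕ) (P : Polynomial ℂ) :
    form (d + 1) (Polynomial.X * P) = x ^ 3 * form d P := by
  rw [form, Finset.sum_range_succ', Polynomial.coeff_X_mul_zero, zero_smul, add_zero, form,
    Finset.mul_sum]
  refine Finset.sum_congr rfl fun i _ => ?_
  rw [Polynomial.coeff_X_mul, Nat.add_sub_add_right, mul_smul_comm, pow_succ]
  congr 1
  ring

theorem form_sub_C_mul (d : ℕ) (P : Polynomial ℂ) (Q : Polynomial ℂ) (r : ℂ) :
    form d (P - Polynomial.C r * Q) = form d P - r • form d Q := by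
  simp only [form, Polynomial.coeff_sub, Polynomial.coeff_C_mul, sub_smul, mul_smul,
    Finset.sum_sub_distrib, Finset.smul_sum]

theorem exists_form_of_mem_piece {d : ℕ} {a : Ae7} (ha : a ∈ piece (12 * d)) :
    ∃ P : Polynomial ℂ, P.natDegree ≤ d ∧ a = form d P := by
  induction ha using Submodule.span_induction with
  | zero => exact ⟨0, by simp, by simp [form]⟩
  | add a b _ _ ha hb =>
    obtain ⟨P, hP, rfl⟩ := ha
    obtain ⟨Q, hQ, rfl⟩ := hb
    exact ⟨P + Q, Polynomial.natDegree_add_le_of_degree_le hP hQ, by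
      simp only [form, Polynomial.coeff_add, add_smul, Finset.sum_add_distrib]⟩
  | smul r a _ ha =>
    obtain ⟨P, hP, rfl⟩ := ha
    exact ⟨r • P, (Polynomial.natDegree_smul_le r P).trans hP, by
      simp only [form, Polynomial.coeff_smul, smul_assoc, Finset.smul_sum]⟩
  | mem a ha =>
    obtain ⟨i, j, k, hk, he, rfl⟩ := ha
    obtain rfl : k = 0 := by omega
    obtain ⟨i, rfl⟩ : ∃ i', i = 3 * i' := ⟨i / 3, by omega⟩
    obtain ⟨j, rfl⟩ : ∃ j', j = 2 * j' := ⟨j / 2, by omega⟩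
    obtain rfl : d = i + j := by omega
    refine ⟨Polynomial.X ^ i, by simp, ?_⟩
    rw [form, Finset.sum_eq_single_of_mem i (by simp)]
    · simp [pow_mul]
    · intro l _ hl
      simp [Polynomial.coeff_X_pow, hl]

theorem exists_linear_form_mem_ker {D : Derivation ℂ Ae7 Ae7} (hD : ∀ a, ∃ n, D^[n] a = 0)
    {d : ℕ} (hd : 0 < d) {P : Polynomial ℂ} (hP : P.natDegree ≤ d)
    (h0 : form d P ≠ 0) (hDP : D (form d P) = 0) :
    ∃ a b : ℂ, ¬(a = 0 ∧ b = 0) ∧ D (a • x ^ 3 + b • y ^ 2) = 0 := by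
  obtain ⟨d, rfl⟩ := Nat.exists_eq_succ_of_ne_zero hd.ne'
  by_cases hc : P.coeff (d + 1) = 0
  · rw [Nat.succ_eq_add_one, form_succ_of_coeff_eq_zero hc] at h0 hDP
    exact ⟨0, 1, by simp, by simpa using Derivation.apply_eq_zero_of_mul hD h0 hDP⟩
  · have hPd : P.natDegree = d + 1 := le_antisymm hP (Polynomial.le_natDegree_of_ne_zero hc)
    obtain ⟨r, hr⟩ := IsAlgClosed.exists_root P
      (Polynomial.degree_ne_of_natDegree_ne (by omega : P.natDegree ≠ 0))
    obtain ⟨Q, rfl⟩ := Polynomial.dvd_iff_isRoot.mpr hr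
    have hQ0 : Q ≠ 0 := by
      rintro rfl
      simp at hc
    rw [Polynomial.natDegree_mul (Polynomial.X_sub_C_ne_zero r) hQ0,
      Polynomial.natDegree_X_sub_C] at hPd
    have hQ : Q.coeff (d + 1) = 0 := Polynomial.coeff_eq_zero_of_natDegree_lt (by omega)
    have key : form (d + 1) ((Polynomial.X - Polynomial.C r) * Q) =
        (x ^ 3 - r • y ^ 2) * form d Q := by
      rw [sub_mul, form_sub_C_mul, form_succ_X_mul, form_succ_of_coeff_eq_zero hQ, sub_mul,
        smul_mul_assoc]
    rw [Nat.succ_eq_add_one, key] at h0 hDP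
    refine ⟨1, -r, by simp, ?_⟩
    rw [one_smul, neg_smul, ← sub_eq_add_neg]
    exact Derivation.apply_eq_zero_of_mul hD h0 hDP

theorem eq_zero_of_linear_form_mem_ker {D : Derivation ℂ Ae7 Ae7}
    (hD : ∀ a, ∃ n, D^[n] a = 0) {a b : ℂ} (hab : ¬(a = 0 ∧ b = 0))
    (h : D (a • x ^ 3 + b • y ^ 2) = 0) : D = 0 := by
  have hz : D x = 0 → D y = 0 → D z = 0 := fun hx hy => by
    refine Derivation.apply_eq_zero_of_pow hD z_ne_zero 1 ?_
    have hz2 : z ^ (1 + 1) = -(x ^ 3 * y + y ^ 3) := by linear_combination relation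
    rw [hz2]
    simp [D.leibniz_pow, hx, hy]
  rw [D.map_add, D.map_smul, D.map_smul] at h
  by_cases ha : a = 0
  · have hb : b ≠ 0 := fun hb => hab ⟨ha, hb⟩
    have hy : D y = 0 := Derivation.apply_eq_zero_of_pow hD y_ne_zero 1 (by
      simpa only [ha, zero_smul, zero_add, smul_eq_zero, hb, false_or] using h)
    obtain ⟨hx, hz⟩ := Derivation.apply_eq_zero_of_cubic_add_sq hD (a := y) (b := 1)
      (k := -y ^ 3) (u := x) (w := z) y_ne_zero one_ne_zero
      (neg_ne_zero.mpr (pow_ne_zero 3 y_ne_zero)) hy D.map_one_eq_zero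
      (by simp [D.leibniz_pow, hy]) (by linear_combination relation)
    exact derivation_eq_zero hx hy hz
  by_cases hb : b = 0
  · have hx : D x = 0 := Derivation.apply_eq_zero_of_pow hD x_ne_zero 2 (by
      simpa only [hb, zero_smul, add_zero, smul_eq_zero, ha, false_or] using h)
    have hy : D y = 0 := Derivation.apply_eq_zero_of_cubic_add_linear hD (k := x ^ 3) (w := z)
      (pow_ne_zero 3 x_ne_zero) (by simp [D.leibniz_pow, hx]) (by linear_combination relation)
    exact derivation_eq_zero hx hy (hz hx hy)
  · obtain ⟨hx, hy⟩ := Derivation.apply_eq_zero_of_cubic_add_sq hD (a := algebraMap ℂ Ae7 a)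
      (b := algebraMap ℂ Ae7 b) (k := a • x ^ 3 + b • y ^ 2) (u := x) (w := y)
      (by simpa using ha) (by simpa using hb) (fun h0 => hab (smul_x_cube_add_smul_y_sq h0))
      (D.map_algebraMap a) (D.map_algebraMap b) (by rw [D.map_add, D.map_smul, D.map_smul, h])
      (congrArg₂ (· + ·) (Algebra.smul_def _ _).symm (Algebra.smul_def _ _).symm)
    exact derivation_eq_zero hx hy (hz hx hy)

/-- The algebra has no nonzero locally nilpotent homogeneous derivation of positive degree. -/
theorem component_eq_zero_of_locallyNilpotent {E : Derivation ℂ Ae7 Ae7} {M : ℕ} (hM : 0 < M)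
    (hD : ∀ a, ∃ n, (grading.component E M)^[n] a = 0) : grading.component E M = 0 := by
  by_contra hne
  have key : ∀ e a, grading.IsHom e a → grading.component E M a = 0 := by
    intro e a ha
    by_contra h0
    obtain ⟨n, hn⟩ := Derivation.exists_hasDegree hD (a := a) fun h => h0 (by rw [h, map_zero])
    obtain ⟨m, rfl, -⟩ := hn.apply h0
    set d := e + (m + 1) * M
    have hd0 : 0 < d := by positivity
    have hhom : grading.IsHom (12 * d) (((grading.component E M)^[m + 1] a) ^ 12) :=
      (ha.isHom_component_iterate E M (m + 1)).pow 12
    obtain ⟨P, hP, hPa⟩ := exists_form_of_mem_piece (mem_piece hhom)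
    have hker : grading.component E M ((grading.component E M)^[m + 1] a) = 0 := by
      simpa only [Function.iterate_succ_apply'] using hn.2
    obtain ⟨r, s, hrs, h⟩ := exists_linear_form_mem_ker hD hd0 hP
      (hPa ▸ pow_ne_zero 12 hn.1) (by rw [← hPa, Derivation.leibniz_pow, hker]; simp)
    exact hne (eq_zero_of_linear_form_mem_ker hD hrs h)
  exact hne (derivation_eq_zero (key _ _ isHom_x) (key _ _ isHom_y) (key _ _ isHom_z))

theorem component_conjEuler_eq_zero (φ : Ae7 ≃ₐ[ℂ] Ae7) {M : ℕ} (hM : 0 < M) :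
    grading.component (grading.conjEuler φ) M = 0 := by
  set E := grading.conjEuler φ
  set N := (grading.hom (E x)).natDegree + (grading.hom (E y)).natDegree +
    (grading.hom (E z)).natDegree
  have hlarge : ∀ k, N < k → grading.component E k = 0 := fun k hk => by
    refine derivation_eq_zero ?_ ?_ ?_
    · rw [isHom_x.component]
      exact Polynomial.coeff_eq_zero_of_natDegree_lt (by omega)
    · rw [isHom_y.component]
      exact Polynomial.coeff_eq_zero_of_natDegree_lt (by omega)
    · rw [isHom_z.component]
      exact Polynomial.coeff_eq_zero_of_natDegree_lt (by omega)
  have hdesc : ∀ j k, 0 < k → N < k + j → grading.component E k = 0 := by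
    intro j
    induction j with
    | zero => exact fun k _ hk => hlarge k hk
    | succ j ih =>
      intro k hk hkj
      exact component_eq_zero_of_locallyNilpotent hk
        (NatCoaction.component_locallyNilpotent hk (fun l hl => ih l (by omega) (by omega))
          (NatCoaction.exists_natDegree_conjEuler_iterate_le φ))
  exact hdesc (N + 1) M hM (by omega)

theorem isHom_algebraMap (r : ℂ) : grading.IsHom 0 (algebraMap ℂ Ae7 r) := by
  rw [Algebra.algebraMap_eq_smul_one]
  exact NatCoaction.isHom_one.smul r

theorem smul_eq_algebraMap_mul (r : ℂ) (a : Ae7) : r • a = algebraMap ℂ Ae7 r * a :=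
  Algebra.smul_def r a

theorem conjEuler_eq_sum_coeff (φ : Ae7 ≃ₐ[ℂ] Ae7) {e : ℕ} {a : Ae7} (ha : grading.IsHom e a) :
    grading.conjEuler φ a =
      ∑ j ∈ Finset.range (e + 1), (grading.hom (grading.conjEuler φ a)).coeff j := by
  have hdeg : (grading.hom (grading.conjEuler φ a)).natDegree ≤ e := by
    refine Polynomial.natDegree_le_iff_coeff_eq_zero.mpr fun j hj => ?_
    obtain ⟨M, rfl⟩ := Nat.exists_eq_add_of_lt hj
    rw [add_assoc, ← ha.component, component_conjEuler_eq_zero φ (Nat.succ_pos M),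
      Derivation.zero_apply]
  conv_lhs => rw [← grading.eval_one (grading.conjEuler φ a),
    Polynomial.eval_eq_sum_range' (Nat.lt_succ_of_le hdeg)]
  simp

theorem exists_conjEuler_x (φ : Ae7 ≃ₐ[ℂ] Ae7) :
    ∃ a₀ a₁ : ℂ, grading.conjEuler φ x = algebraMap ℂ Ae7 a₀ + algebraMap ℂ Ae7 a₁ * x := by
  have hm := coeff_mem_piece (grading.conjEuler φ x)
  obtain ⟨a₀, h₀⟩ := exists_eq_smul_of_mem_piece 0 0 0 (by omega) (hm 0)
  obtain ⟨a₁, h₁⟩ := exists_eq_smul_of_mem_piece 1 0 0 (by omega) (hm 4)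
  refine ⟨a₀, a₁, ?_⟩
  rw [conjEuler_eq_sum_coeff φ isHom_x]
  simp only [Finset.sum_range_succ, Finset.sum_range_zero, h₀, h₁,
    eq_zero_of_mem_piece (by omega) (hm 1), eq_zero_of_mem_piece (by omega) (hm 2),
    eq_zero_of_mem_piece (by omega) (hm 3), smul_eq_algebraMap_mul]
  ring

theorem exists_conjEuler_y (φ : Ae7 ≃ₐ[ℂ] Ae7) :
    ∃ b₀ b₁ b₂ : ℂ, grading.conjEuler φ y =
      algebraMap ℂ Ae7 b₀ + algebraMap ℂ Ae7 b₁ * x + algebraMap ℂ Ae7 b₂ * y := by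
  have hm := coeff_mem_piece (grading.conjEuler φ y)
  obtain ⟨b₀, h₀⟩ := exists_eq_smul_of_mem_piece 0 0 0 (by omega) (hm 0)
  obtain ⟨b₁, h₁⟩ := exists_eq_smul_of_mem_piece 1 0 0 (by omega) (hm 4)
  obtain ⟨b₂, h₂⟩ := exists_eq_smul_of_mem_piece 0 1 0 (by omega) (hm 6)
  refine ⟨b₀, b₁, b₂, ?_⟩
  rw [conjEuler_eq_sum_coeff φ isHom_y]
  simp only [Finset.sum_range_succ, Finset.sum_range_zero, h₀, h₁, h₂,
    eq_zero_of_mem_piece (by omega) (hm 1), eq_zero_of_mem_piece (by omega) (hm 2),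
    eq_zero_of_mem_piece (by omega) (hm 3), eq_zero_of_mem_piece (by omega) (hm 5),
    smul_eq_algebraMap_mul]
  ring

theorem exists_conjEuler_z (φ : Ae7 ≃ₐ[ℂ] Ae7) :
    ∃ c₀ c₁ c₂ c₃ c₄ : ℂ, grading.conjEuler φ z =
      algebraMap ℂ Ae7 c₀ + algebraMap ℂ Ae7 c₁ * x + algebraMap ℂ Ae7 c₂ * y +
        algebraMap ℂ Ae7 c₃ * x ^ 2 + algebraMap ℂ Ae7 c₄ * z := by
  have hm := coeff_mem_piece (grading.conjEuler φ z)
  obtain ⟨c₀, h₀⟩ := exists_eq_smul_of_mem_piece 0 0 0 (by omega) (hm 0)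
  obtain ⟨c₁, h₁⟩ := exists_eq_smul_of_mem_piece 1 0 0 (by omega) (hm 4)
  obtain ⟨c₂, h₂⟩ := exists_eq_smul_of_mem_piece 0 1 0 (by omega) (hm 6)
  obtain ⟨c₃, h₃⟩ := exists_eq_smul_of_mem_piece 2 0 0 (by omega) (hm 8)
  obtain ⟨c₄, h₄⟩ := exists_eq_smul_of_mem_piece 0 0 1 (by omega) (hm 9)
  refine ⟨c₀, c₁, c₂, c₃, c₄, ?_⟩
  rw [conjEuler_eq_sum_coeff φ isHom_z]
  simp only [Finset.sum_range_succ, Finset.sum_range_zero, h₀, h₁, h₂, h₃, h₄,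
    eq_zero_of_mem_piece (by omega) (hm 1), eq_zero_of_mem_piece (by omega) (hm 2),
    eq_zero_of_mem_piece (by omega) (hm 3), eq_zero_of_mem_piece (by omega) (hm 5),
    eq_zero_of_mem_piece (by omega) (hm 7), smul_eq_algebraMap_mul]
  ring

theorem derivation_relation (E : Derivation ℂ Ae7 Ae7) :
    3 * x ^ 2 * y * E x + (x ^ 3 + 3 * y ^ 2) * E y + 2 * z * E z = 0 := by
  have h := congrArg E relation
  simp only [E.map_add, E.leibniz, E.leibniz_pow, smul_eq_mul, nsmul_eq_mul, E.map_zero] at h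
  push_cast at h
  linear_combination h

theorem algebraMap_mul_quadratic_eq_zero {a b : ℂ}
    (h : algebraMap ℂ Ae7 a * x ^ 3 + algebraMap ℂ Ae7 b * y ^ 2 = 0) : a = 0 ∧ b = 0 :=
  smul_x_cube_add_smul_y_sq (by rw [smul_eq_algebraMap_mul, smul_eq_algebraMap_mul, h])

theorem conjEuler_diagonal (φ : Ae7 ≃ₐ[ℂ] Ae7) :
    ∃ a b c : ℂ, 3 * a = 2 * b ∧ 3 * b = 2 * c ∧ grading.conjEuler φ x = a • x ∧
      grading.conjEuler φ y = b • y ∧ grading.conjEuler φ z = c • z := by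
  obtain ⟨a₀, a₁, hx⟩ := exists_conjEuler_x φ
  obtain ⟨b₀, b₁, b₂, hy⟩ := exists_conjEuler_y φ
  obtain ⟨c₀, c₁, c₂, c₃, c₄, hz⟩ := exists_conjEuler_z φ
  have hrel := derivation_relation (grading.conjEuler φ)
  rw [hx, hy, hz] at hrel
  have h2 : grading.IsHom 0 (2 : Ae7) := by
    rw [← map_ofNat (algebraMap ℂ Ae7) 2]
    exact isHom_algebraMap 2
  have h3 : grading.IsHom 0 (3 : Ae7) := by
    rw [← map_ofNat (algebraMap ℂ Ae7) 3]
    exact isHom_algebraMap 3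
  have hC := isHom_algebraMap
  have : CharZero Ae7 := charZero_of_injective_algebraMap (algebraMap ℂ Ae7).injective
  have hq : grading.IsHom 12 (x ^ 3 + 3 * y ^ 2) :=
    (isHom_x.pow 3).add (h3.mul (isHom_y.pow 2))
  have t9 := (h2.mul isHom_z).mul (hC c₀)
  have t12 := hq.mul (hC b₀)
  have t13 := (h2.mul isHom_z).mul ((hC c₁).mul isHom_x)
  have t14 := ((h3.mul (isHom_x.pow 2)).mul isHom_y).mul (hC a₀)
  have t15 := (h2.mul isHom_z).mul ((hC c₂).mul isHom_y)
  have t16 := hq.mul ((hC b₁).mul isHom_x)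
  have t17 := (h2.mul isHom_z).mul ((hC c₃).mul (isHom_x.pow 2))
  have t18 := ((((h3.mul (isHom_x.pow 2)).mul isHom_y).mul ((hC a₁).mul isHom_x)).add
    (hq.mul ((hC b₂).mul isHom_y))).add ((h2.mul isHom_z).mul ((hC c₄).mul isHom_z))
  rw [NatCoaction.IsHom] at t9 t12 t13 t14 t15 t16 t17 t18
  have hsum := congrArg grading.hom hrel
  have hsplit : 3 * x ^ 2 * y * (algebraMap ℂ Ae7 a₀ + algebraMap ℂ Ae7 a₁ * x) +
      (x ^ 3 + 3 * y ^ 2) *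
        (algebraMap ℂ Ae7 b₀ + algebraMap ℂ Ae7 b₁ * x + algebraMap ℂ Ae7 b₂ * y) +
      2 * z * (algebraMap ℂ Ae7 c₀ + algebraMap ℂ Ae7 c₁ * x + algebraMap ℂ Ae7 c₂ * y +
        algebraMap ℂ Ae7 c₃ * x ^ 2 + algebraMap ℂ Ae7 c₄ * z) =
      2 * z * algebraMap ℂ Ae7 c₀ + (x ^ 3 + 3 * y ^ 2) * algebraMap ℂ Ae7 b₀ +
      2 * z * (algebraMap ℂ Ae7 c₁ * x) + 3 * x ^ 2 * y * algebraMap ℂ Ae7 a₀ +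
      2 * z * (algebraMap ℂ Ae7 c₂ * y) + (x ^ 3 + 3 * y ^ 2) * (algebraMap ℂ Ae7 b₁ * x) +
      2 * z * (algebraMap ℂ Ae7 c₃ * x ^ 2) +
      (3 * x ^ 2 * y * (algebraMap ℂ Ae7 a₁ * x) +
        (x ^ 3 + 3 * y ^ 2) * (algebraMap ℂ Ae7 b₂ * y) +
        2 * z * (algebraMap ℂ Ae7 c₄ * z)) := by ring
  rw [hsplit] at hsum
  simp only [map_zero] at hsum
  rw [map_add, map_add, map_add, map_add, map_add, map_add, map_add,
    t9, t12, t13, t14, t15, t16, t17, t18] at hsum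
  have hcoeff := fun n => congrArg (fun p => Polynomial.coeff p n) hsum
  simp only [Polynomial.coeff_add, Polynomial.coeff_monomial, Polynomial.coeff_zero] at hcoeff
  have e9 := hcoeff 9
  have e12 := hcoeff 12
  have e13 := hcoeff 13
  have e14 := hcoeff 14
  have e15 := hcoeff 15
  have e16 := hcoeff 16
  have e17 := hcoeff 17
  have e18 := hcoeff 18
  norm_num [x_ne_zero, y_ne_zero, z_ne_zero] at e9 e12 e13 e14 e15 e16 e17 e18
  have hne : x ^ 3 + 3 * y ^ 2 ≠ 0 := fun h0 =>
    one_ne_zero (algebraMap_mul_quadratic_eq_zero (a := 1) (b := 3)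
      (by rw [map_one, map_ofNat, one_mul, h0])).1
  have e12 := e12.resolve_left hne
  have e16 := e16.resolve_left hne
  have hy_mul : y * (algebraMap ℂ Ae7 (3 * a₁ + b₂ - 2 * c₄) * x ^ 3 +
      algebraMap ℂ Ae7 (3 * b₂ - 2 * c₄) * y ^ 2) = 0 := by
    simp only [map_add, map_sub, map_mul, map_ofNat]
    linear_combination e18 - 2 * algebraMap ℂ Ae7 c₄ * relation
  obtain ⟨h₁, h₂⟩ :=
    algebraMap_mul_quadratic_eq_zero ((mul_eq_zero.mp hy_mul).resolve_left y_ne_zero)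
  refine ⟨a₁, b₂, c₄, by linear_combination h₁ - h₂, by linear_combination h₂, ?_, ?_, ?_⟩
  · rw [hx, e14, smul_eq_algebraMap_mul, map_zero, zero_add]
  · rw [hy, e12, e16, smul_eq_algebraMap_mul, map_zero, zero_mul, zero_add, zero_add]
  · rw [hz, e9, e13, e15, e17, smul_eq_algebraMap_mul, map_zero, zero_mul, zero_mul, zero_mul,
      add_zero, add_zero, add_zero, zero_add]

/-- An automorphism multiplies all weights by a common integer. -/
theorem exists_isHom_map (θ : Ae7 ≃ₐ[ℂ] Ae7) :
    ∃ m : ℕ, ∀ e a, grading.IsHom e a → grading.IsHom (m * e) (θ a) := by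
  obtain ⟨a, b, c, hab, hbc, hx, hy, hz⟩ := conjEuler_diagonal θ.symm
  have key : ∀ {u : Ae7} {r : ℂ}, u ≠ 0 → grading.conjEuler θ.symm u = r • u →
      ∃ d : ℕ, r = d ∧ grading.IsHom d (θ u) := fun {u r} hu h => by
    refine NatCoaction.exists_isHom_of_euler_eq_smul (by simpa using hu) ?_
    have h' := congrArg θ h
    rw [NatCoaction.conjEuler_apply, AlgEquiv.apply_symm_apply, AlgEquiv.symm_symm,
      map_smul] at h'
    exact h'
  obtain ⟨p, rfl, hp⟩ := key x_ne_zero hx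
  obtain ⟨q, rfl, hq⟩ := key y_ne_zero hy
  obtain ⟨r, rfl, hr⟩ := key z_ne_zero hz
  norm_cast at hab hbc
  obtain ⟨m, rfl⟩ : ∃ m, p = m * 4 := ⟨p / 4, by omega⟩
  obtain rfl : q = m * 6 := by omega
  obtain rfl : r = m * 9 := by omega
  refine ⟨m, fun e u hu => ?_⟩
  have hmem := mem_piece hu
  rw [piece] at hmem
  clear hu
  induction hmem using Submodule.span_induction with
  | mem u hu =>
    obtain ⟨i, j, k, -, rfl, rfl⟩ := hu
    rw [map_mul, map_mul, map_pow, map_pow, map_pow]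
    convert ((hp.pow i).mul (hq.pow j)).mul (hr.pow k) using 1
    ring
  | zero =>
    rw [map_zero]
    exact NatCoaction.isHom_zero _
  | add u v _ _ hu hv =>
    rw [map_add]
    exact hu.add hv
  | smul r u _ hu =>
    rw [map_smul]
    exact hu.smul r

theorem isHom_map (θ : Ae7 ≃ₐ[ℂ] Ae7) {e : ℕ} {a : Ae7} (ha : grading.IsHom e a) :
    grading.IsHom e (θ a) := by
  obtain ⟨m, hm⟩ := exists_isHom_map θ
  obtain ⟨n, hn⟩ := exists_isHom_map θ.symm
  have h4 := hn _ _ (hm _ _ isHom_x)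
  rw [AlgEquiv.symm_apply_apply] at h4
  have h1 : n * m = 1 := by
    have := h4.unique isHom_x x_ne_zero
    rw [← mul_assoc] at this
    omega
  have h := hm _ _ ha
  rwa [Nat.eq_one_of_mul_eq_one_left h1, one_mul] at h

theorem exists_map_eq_smul (θ : Ae7 ≃ₐ[ℂ] Ae7) :
    ∃ t : ℂˣ, θ x = (t : ℂ) ^ 4 • x ∧ θ y = (t : ℂ) ^ 6 • y ∧ θ z = (t : ℂ) ^ 9 • z := by
  obtain ⟨α, hα⟩ := exists_eq_smul_of_mem_piece 1 0 0 (by omega) (mem_piece (isHom_map θ isHom_x))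
  obtain ⟨β, hβ⟩ := exists_eq_smul_of_mem_piece 0 1 0 (by omega) (mem_piece (isHom_map θ isHom_y))
  obtain ⟨γ, hγ⟩ := exists_eq_smul_of_mem_piece 0 0 1 (by omega) (mem_piece (isHom_map θ isHom_z))
  simp only [pow_one, pow_zero, mul_one, one_mul] at hα hβ hγ
  have hne : ∀ {u : Ae7} {r : ℂ}, u ≠ 0 → θ u = r • u → r ≠ 0 := by
    rintro u _ hu h rfl
    rw [zero_smul] at h
    exact hu (by simpa using h)
  have hα0 := hne x_ne_zero hα
  have hβ0 := hne y_ne_zero hβ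
  have hγ0 := hne z_ne_zero hγ
  have hrel := congrArg θ relation
  rw [map_add, map_add, map_mul, map_pow, map_pow, map_pow, map_zero, hα, hβ, hγ] at hrel
  simp only [smul_eq_algebraMap_mul] at hrel
  have hy_mul : y * (algebraMap ℂ Ae7 (α ^ 3 * β - γ ^ 2) * x ^ 3 +
      algebraMap ℂ Ae7 (β ^ 3 - γ ^ 2) * y ^ 2) = 0 := by
    simp only [map_sub, map_mul, map_pow]
    linear_combination hrel - algebraMap ℂ Ae7 γ ^ 2 * relation
  obtain ⟨h₁, h₂⟩ :=
    algebraMap_mul_quadratic_eq_zero ((mul_eq_zero.mp hy_mul).resolve_left y_ne_zero)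
  have h₃ : α ^ 3 = β ^ 2 := mul_right_cancel₀ hβ0 (by linear_combination h₁ - h₂)
  have h₄ : γ ^ 2 = β ^ 3 := by linear_combination -h₂
  have h4 : (γ / α ^ 2) ^ 4 = α := by
    field_simp
    linear_combination (γ ^ 2 + β ^ 3) * h₄ - (α ^ 6 + α ^ 3 * β ^ 2 + β ^ 4) * h₃
  have h6 : (γ / α ^ 2) ^ 6 = β := by
    field_simp
    linear_combination (γ ^ 4 + γ ^ 2 * β ^ 3 + β ^ 6) * h₄ -
      β * (α ^ 9 + α ^ 6 * β ^ 2 + α ^ 3 * β ^ 4 + β ^ 6) * h₃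
  have h9 : (γ / α ^ 2) ^ 9 = γ := by
    calc (γ / α ^ 2) ^ 9 = ((γ / α ^ 2) ^ 4) ^ 2 * (γ / α ^ 2) := by ring
      _ = γ := by rw [h4, mul_div_cancel₀ _ (pow_ne_zero 2 hα0)]
  refine ⟨Units.mk0 (γ / α ^ 2) (div_ne_zero hγ0 (pow_ne_zero 2 hα0)), ?_⟩
  rw [Units.val_mk0, h4, h6, h9]
  exact ⟨hα, hβ, hγ⟩

/-- The endomorphism `x ↦ t⁴ x`, `y ↦ t⁶ y`, `z ↦ t⁹ z`. -/
def scaleHom (t : ℂ) : Ae7 →ₐ[ℂ] Ae7 :=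
  lift (t ^ 4 • x) (t ^ 6 • y) (t ^ 9 • z) (by
    simp only [smul_eq_algebraMap_mul, map_pow]
    linear_combination algebraMap ℂ Ae7 t ^ 18 * relation)

theorem scaleHom_x (t : ℂ) : scaleHom t x = t ^ 4 • x := lift_x ..

theorem scaleHom_y (t : ℂ) : scaleHom t y = t ^ 6 • y := lift_y ..

theorem scaleHom_z (t : ℂ) : scaleHom t z = t ^ 9 • z := lift_z ..

theorem scaleHom_one : scaleHom 1 = AlgHom.id ℂ Ae7 :=
  algHom_ext (by rw [scaleHom_x, one_pow, one_smul, AlgHom.id_apply])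
    (by rw [scaleHom_y, one_pow, one_smul, AlgHom.id_apply])
    (by rw [scaleHom_z, one_pow, one_smul, AlgHom.id_apply])

theorem scaleHom_mul (s t : ℂ) : scaleHom (s * t) = (scaleHom s).comp (scaleHom t) :=
  algHom_ext
    (by rw [AlgHom.comp_apply, scaleHom_x, scaleHom_x, map_smul, scaleHom_x, smul_smul, mul_pow,
      mul_comm])
    (by rw [AlgHom.comp_apply, scaleHom_y, scaleHom_y, map_smul, scaleHom_y, smul_smul, mul_pow,
      mul_comm])
    (by rw [AlgHom.comp_apply, scaleHom_z, scaleHom_z, map_smul, scaleHom_z, smul_smul, mul_pow,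
      mul_comm])

/-- The action of `ℂ*` on `Ae7` by the automorphisms `x ↦ t⁴ x`, `y ↦ t⁶ y`, `z ↦ t⁹ z`. -/
def scale : ℂˣ →* (Ae7 ≃ₐ[ℂ] Ae7) where
  toFun t := AlgEquiv.ofAlgHom (scaleHom t) (scaleHom (t⁻¹ : ℂˣ))
    (by rw [← scaleHom_mul, Units.mul_inv, scaleHom_one])
    (by rw [← scaleHom_mul, Units.inv_mul, scaleHom_one])
  map_one' := AlgEquiv.ext fun a => DFunLike.congr_fun scaleHom_one a
  map_mul' s t := AlgEquiv.ext fun a => DFunLike.congr_fun (scaleHom_mul s t) a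

theorem scale_injective : Function.Injective scale := by
  intro s t h
  have happ : ∀ a, scaleHom s a = scaleHom t a := fun a => DFunLike.congr_fun h a
  have h4 := happ x
  rw [scaleHom_x, scaleHom_x] at h4
  have h4 := smul_left_injective ℂ x_ne_zero h4
  have h9 := happ z
  rw [scaleHom_z, scaleHom_z] at h9
  have h9 := smul_left_injective ℂ z_ne_zero h9
  refine Units.ext (mul_left_cancel₀ (pow_ne_zero 8 s.ne_zero) ?_)
  linear_combination h9 - (t : ℂ) * ((s : ℂ) ^ 4 + (t : ℂ) ^ 4) * h4

theorem scale_surjective : Function.Surjective scale := by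
  intro θ
  obtain ⟨t, hx, hy, hz⟩ := exists_map_eq_smul θ
  have h : scaleHom t = (θ : Ae7 →ₐ[ℂ] Ae7) :=
    algHom_ext ((scaleHom_x t).trans hx.symm) ((scaleHom_y t).trans hy.symm)
      ((scaleHom_z t).trans hz.symm)
  exact ⟨t, AlgEquiv.ext fun a => DFunLike.congr_fun h a⟩

end E7

/-- Aut(A) ≅ ℂ*, via t ↦ (x ↦ t^4 x, y ↦ t^6 y, z ↦ t^9 z). -/
theorem e7_aut_group :
    ∃ e : ℂˣ ≃* (Ae7 ≃ₐ[ℂ] Ae7),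
      ∀ t : ℂˣ,
        e t (Ideal.Quotient.mk Ie7 (X 0)) =
          ((t : ℂ) ^ 4) • Ideal.Quotient.mk Ie7 (X 0) ∧
        e t (Ideal.Quotient.mk Ie7 (X 1)) =
          ((t : ℂ) ^ 6) • Ideal.Quotient.mk Ie7 (X 1) ∧
        e t (Ideal.Quotient.mk Ie7 (X 2)) =
          ((t : ℂ) ^ 9) • Ideal.Quotient.mk Ie7 (X 2) :=
  ⟨MulEquiv.ofBijective E7.scale ⟨E7.scale_injective, E7.scale_surjective⟩,
    fun t => ⟨E7.scaleHom_x t, E7.scaleHom_y t, E7.scaleHom_z t⟩⟩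

end
end

section
/- Let n ≥ 5 be an integer. Every ℂ-algebra automorphism φ of A = ℂ[x,y,z]/(x^{n−1} + x y² + z²) is diagonal: there exist λ ∈ ℂ* and signs ε, ε' ∈ {1, −1} such that φ(x) = λ²x, φ(y) = ελ^{n−2}y, φ(z) = ε'λ^{n−1}z, where x, y, z denote the images of the variables in A. In particular, every automorphism of the Klein surface {x^{n−1} + x y² + z² = 0} ⊂ ℂ³ extends to a diagonal linear automorphism of ℂ³. -/
open MvPolynomial

noncomputable section

/-- The ideal (x^(n−1) + x y² + z²) in ℂ[x,y,z]. -/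
def Idn (n : ℕ) : Ideal (MvPolynomial (Fin 3) ℂ) :=
  Ideal.span {(X 0 ^ (n - 1) + X 0 * X 1 ^ 2 + X 2 ^ 2 : MvPolynomial (Fin 3) ℂ)}

/-- The coordinate ring A = ℂ[x,y,z]/(x^(n−1) + x y² + z²) of the Klein surface Dₙ. -/
abbrev Adn (n : ℕ) : Type := MvPolynomial (Fin 3) ℂ ⧸ Idn n

/-- The polynomial ring `ℂ[u, v]`, with `u = X 0` and `v = X 1`. -/
abbrev Plane : Type := MvPolynomial (Fin 2) ℂ

/-- The image in `Adn n` of the `i`-th variable. -/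
abbrev Adn.gen (n : ℕ) (i : Fin 3) : Adn n := Ideal.Quotient.mk (Idn n) (X i)

lemma Adn.relation (m : ℕ) :
    gen (m + 2) 0 ^ (m + 1) + gen (m + 2) 0 * gen (m + 2) 1 ^ 2 + gen (m + 2) 2 ^ 2 = 0 := by
  have h : (X 0 ^ (m + 1) + X 0 * X 1 ^ 2 + X 2 ^ 2 : MvPolynomial (Fin 3) ℂ) ∈ Idn (m + 2) :=
    Ideal.subset_span rfl
  simpa using Ideal.Quotient.eq_zero_iff_mem.mpr h

/-- The images of `x, y, z` under the quotient map `ℂ² → ℂ² / BD₄ₘ`, evaluated at `(U, V)`. -/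
def dihedralInvariants {R : Type*} [CommRing R] [Algebra ℂ R] (m : ℕ) (U V : R) : Fin 3 → R :=
  ![(U * V) ^ 2, (Complex.I / 2) • (U ^ (2 * m) + V ^ (2 * m)),
    (1 / 2 : ℂ) • (U * V * (U ^ (2 * m) - V ^ (2 * m)))]

lemma dihedralInvariants_relation {R : Type*} [CommRing R] [Algebra ℂ R] (m : ℕ) (U V : R) :
    dihedralInvariants m U V 0 ^ (m + 1) +
      dihedralInvariants m U V 0 * dihedralInvariants m U V 1 ^ 2 +
      dihedralInvariants m U V 2 ^ 2 = 0 := by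
  have hI : algebraMap ℂ R (Complex.I / 2) ^ 2 = - algebraMap ℂ R (1 / 2) ^ 2 := by
    rw [← map_pow, ← map_pow, ← map_neg]; congr 1; rw [div_pow, Complex.I_sq]; norm_num
  have h4 : algebraMap ℂ R (1 / 2) ^ 2 * 4 = 1 := by
    rw [← map_pow, ← map_ofNat (algebraMap ℂ R) 4, ← map_mul]; norm_num
  have hp : ((U * V) ^ 2) ^ (m + 1) = (U * V) ^ 2 * (U ^ (2 * m) * V ^ (2 * m)) := by
    rw [← mul_pow]; ring
  simp only [dihedralInvariants, Algebra.smul_def, Matrix.cons_val_zero, Matrix.cons_val_one,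
    Matrix.cons_val]
  rw [hp]
  linear_combination (U * V) ^ 2 * (U ^ (2 * m) + V ^ (2 * m)) ^ 2 * hI -
    (U * V) ^ 2 * (U ^ (2 * m) * V ^ (2 * m)) * h4

/-- Algebra homomorphisms commute with the formation of the dihedral invariants. -/
lemma map_dihedralInvariants {R S : Type*} [CommRing R] [Algebra ℂ R] [CommRing S] [Algebra ℂ S]
    (f : R →ₐ[ℂ] S) (m : ℕ) (U V : R) (i : Fin 3) :
    f (dihedralInvariants m U V i) = dihedralInvariants m (f U) (f V) i := by
  fin_cases i <;> simp [dihedralInvariants]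

/-- The comorphism `A → ℂ[u, v]` of the quotient map `ℂ² → ℂ² / BD₄ₘ`. -/
def quotientComorphism (m : ℕ) : Adn (m + 2) →ₐ[ℂ] Plane :=
  Ideal.Quotient.liftₐ (Idn (m + 2)) (aeval (dihedralInvariants m (X 0 : Plane) (X 1))) <| by
    intro a ha
    obtain ⟨b, rfl⟩ := Ideal.mem_span_singleton'.mp ha
    rw [map_mul]
    simp only [map_add, map_mul, map_pow, aeval_X]
    rw [Nat.add_succ_sub_one, dihedralInvariants_relation, mul_zero]

lemma quotientComorphism_gen (m : ℕ) (i : Fin 3) :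
    quotientComorphism m (Adn.gen (m + 2) i) = dihedralInvariants m (X 0) (X 1) i :=
  aeval_X _ i

lemma Adn.algHom_ext {n : ℕ} {S : Type*} [CommRing S] [Algebra ℂ S] {f g : Adn n →ₐ[ℂ] S}
    (h : ∀ i, f (gen n i) = g (gen n i)) : f = g := by
  refine Ideal.Quotient.algHom_ext _ ?_
  exact MvPolynomial.algHom_ext h

lemma comp_quotientComorphism_eq_iff {m : ℕ} {S : Type*} [CommRing S] [Algebra ℂ S]
    (θ : Plane →ₐ[ℂ] S) (f : Adn (m + 2) →ₐ[ℂ] S) :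
    θ.comp (quotientComorphism m) = f ↔
      ∀ i, f (Adn.gen (m + 2) i) = dihedralInvariants m (θ (X 0)) (θ (X 1)) i := by
  constructor
  · rintro rfl i
    rw [AlgHom.comp_apply, quotientComorphism_gen, map_dihedralInvariants]
  · intro h
    refine Adn.algHom_ext fun i => ?_
    rw [h, AlgHom.comp_apply, quotientComorphism_gen, map_dihedralInvariants]

/-- The inclusion `ℂ[x, y] → A`. -/
def Adn.ofPlane (n : ℕ) : Plane →ₐ[ℂ] Adn n := aeval ![gen n 0, gen n 1]

/-- `A` is spanned by `1` and `z` over `ℂ[x, y]`. -/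
lemma Adn.exists_eq_add_gen_mul (m : ℕ) (a : Adn (m + 2)) :
    ∃ p q, a = ofPlane (m + 2) p + gen (m + 2) 2 * ofPlane (m + 2) q := by
  obtain ⟨a, rfl⟩ := Ideal.Quotient.mk_surjective a
  induction a using MvPolynomial.induction_on with
  | C c =>
    refine ⟨C c, 0, ?_⟩
    simp only [ofPlane, algHom_C, map_zero, mul_zero, add_zero]
    rfl
  | add a b ha hb =>
    obtain ⟨p, q, h⟩ := ha
    obtain ⟨p', q', h'⟩ := hb
    refine ⟨p + p', q + q', ?_⟩
    rw [map_add, h, h', map_add, map_add]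
    ring
  | mul_X a i ha =>
    obtain ⟨p, q, h⟩ := ha
    rw [map_mul, h]
    fin_cases i
    · refine ⟨p * X 0, q * X 0, ?_⟩
      simp [ofPlane]; ring
    · refine ⟨p * X 1, q * X 1, ?_⟩
      simp [ofPlane]; ring
    · refine ⟨-(X 0 ^ (m + 1) + X 0 * X 1 ^ 2) * q, p, ?_⟩
      have := relation m
      simp only [gen] at this
      simp [ofPlane, - Ideal.Quotient.mk_eq_mk]
      linear_combination aeval ![gen (m + 2) 0, gen (m + 2) 1] q * this

/-- Every point of `ℂ²` with non-zero first coordinate lifts to a solution `(u, v)`. -/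
lemma exists_dihedralInvariants_eq {m : ℕ} (hm : 0 < m) {a : ℂ} (ha : a ≠ 0) (b : ℂ) :
    ∃ u v : ℂ, dihedralInvariants m u v 0 = a ∧ dihedralInvariants m u v 1 = b := by
  obtain ⟨w, rfl⟩ := IsAlgClosed.exists_pow_nat_eq a (n := 2) two_pos
  have hw : w ≠ 0 := by rintro rfl; simp at ha
  obtain ⟨s, hs⟩ := IsAlgClosed.exists_pow_nat_eq ((2 * b / Complex.I) ^ 2 - 4 * w ^ (2 * m))
    (n := 2) two_pos
  set T := (2 * b / Complex.I + s) / 2 with hT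
  have hI : Complex.I ≠ 0 := Complex.I_ne_zero
  have hquad : T * (2 * b / Complex.I - T) = w ^ (2 * m) := by
    linear_combination (-1 / 4) * hs
  have hT0 : T ≠ 0 := by
    intro h
    rw [h, zero_mul] at hquad
    exact pow_ne_zero _ hw hquad.symm
  obtain ⟨u, hu⟩ := IsAlgClosed.exists_pow_nat_eq T (n := 2 * m) (by omega)
  have hu0 : u ≠ 0 := by
    rintro rfl
    rw [zero_pow (by omega)] at hu
    exact hT0 hu.symm
  refine ⟨u, w / u, ?_, ?_⟩
  · simp [dihedralInvariants, mul_div_cancel₀ _ hu0]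
  · have : w ^ (2 * m) / T = 2 * b / Complex.I - T := by
      rw [← hquad]; field_simp
    simp only [dihedralInvariants, Matrix.cons_val_one, Matrix.cons_val_zero, smul_eq_mul]
    rw [div_pow, hu, this]
    field_simp
    ring

lemma quotientComorphism_comp_ofPlane_injective {m : ℕ} (hm : 0 < m) :
    Function.Injective ((quotientComorphism m).comp (Adn.ofPlane (m + 2))) := by
  rw [injective_iff_map_eq_zero]
  intro p hp
  have key : X 0 * p = 0 := by
    refine MvPolynomial.funext fun w => ?_
    rw [map_mul, eval_X, map_zero]
    by_cases hw : w 0 = 0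
    · rw [hw, zero_mul]
    · obtain ⟨u, v, h0, h1⟩ := exists_dihedralInvariants_eq hm hw (w 1)
      have hcomp : ((aeval ![u, v] : Plane →ₐ[ℂ] ℂ).comp
          ((quotientComorphism m).comp (Adn.ofPlane (m + 2)))) = aeval w := by
        refine MvPolynomial.algHom_ext fun i => ?_
        have h := fun i => congrArg (aeval ![u, v] : Plane →ₐ[ℂ] ℂ) (quotientComorphism_gen m i)
        simp only [map_dihedralInvariants, aeval_X] at h
        fin_cases i
        · simpa [Adn.ofPlane, h0] using h 0
        · simpa [Adn.ofPlane, h1] using h 1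
      have := DFunLike.congr_fun hcomp p
      rw [AlgHom.comp_apply, hp, map_zero] at this
      rw [← coe_aeval_eq_eval, RingHom.coe_coe, ← this, mul_zero]
  exact (mul_eq_zero.mp key).resolve_left (X_ne_zero 0)

lemma X_pow_ne_X_pow {N : ℕ} (hN : N ≠ 0) : (X 0 ^ N : Plane) ≠ X 1 ^ N := by
  intro h
  have := congrArg (eval ![1, 0]) h
  simp [hN] at this

lemma quotientComorphism_injective {m : ℕ} (hm : 0 < m) :
    Function.Injective (quotientComorphism m) := by
  rw [injective_iff_map_eq_zero]
  intro a ha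
  obtain ⟨p, q, rfl⟩ := Adn.exists_eq_add_gen_mul m a
  have hinj := (injective_iff_map_eq_zero _).mp (quotientComorphism_comp_ofPlane_injective hm)
  set z : Plane := dihedralInvariants m (X 0) (X 1) 2 with hz
  have hz0 : z ≠ 0 := by
    have := sub_ne_zero.mpr (X_pow_ne_X_pow (N := 2 * m) (by omega))
    simp only [hz, dihedralInvariants, Matrix.cons_val]
    exact smul_ne_zero (by norm_num) (mul_ne_zero (mul_ne_zero (X_ne_zero _) (X_ne_zero _)) this)
  let s : Plane →ₐ[ℂ] Plane := aeval ![X 1, X 0]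
  have hs : (s.comp ((quotientComorphism m).comp (Adn.ofPlane (m + 2)))) =
      (quotientComorphism m).comp (Adn.ofPlane (m + 2)) := by
    refine MvPolynomial.algHom_ext fun i => ?_
    fin_cases i
    · simp [Adn.ofPlane, quotientComorphism_gen, map_dihedralInvariants, s,
        -Ideal.Quotient.mk_eq_mk]
      simp [dihedralInvariants, mul_comm]
    · simp [Adn.ofPlane, quotientComorphism_gen, map_dihedralInvariants, s,
        -Ideal.Quotient.mk_eq_mk]
      simp [dihedralInvariants, add_comm]
  have hsz : s z = -z := by
    simp only [hz, map_dihedralInvariants, s, aeval_X]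
    simp only [dihedralInvariants, Matrix.cons_val, Matrix.cons_val_zero, Matrix.cons_val_one,
      ← smul_neg]
    congr 1
    ring
  have e1 : (quotientComorphism m).comp (Adn.ofPlane (m + 2)) p +
      z * (quotientComorphism m).comp (Adn.ofPlane (m + 2)) q = 0 := by
    rw [map_add, map_mul, quotientComorphism_gen] at ha
    exact ha
  have e2 := congrArg s e1
  rw [map_add, map_mul, ← AlgHom.comp_apply s, ← AlgHom.comp_apply s, hs, hsz, map_zero] at e2
  have h2 : (2 : Plane) ≠ 0 := two_ne_zero
  have hp : p = 0 := by
    refine hinj p ((mul_eq_zero.mp (?_ : (2 : Plane) * _ = 0)).resolve_left h2)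
    linear_combination e1 + e2
  have hq : q = 0 := by
    refine hinj q ((mul_eq_zero.mp (?_ : z * _ = 0)).resolve_left hz0)
    rw [hp, map_zero, zero_add] at e1
    exact e1
  rw [hp, hq, map_zero, mul_zero, add_zero]

lemma Plane.exists_eq_pow_of_associated {a d : Plane} {k : ℕ} (hk : 0 < k)
    (h : Associated (d ^ k) a) : ∃ e : Plane, a = e ^ k := by
  obtain ⟨r, rfl⟩ := h
  obtain ⟨c, -, hc⟩ := isUnit_iff_eq_C_of_isReduced.mp r.isUnit
  obtain ⟨s, rfl⟩ := IsAlgClosed.exists_pow_nat_eq c hk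
  exact ⟨d * C s, by rw [hc, mul_pow, C_pow]⟩

/-- In `ℂ[u, v]`, the factors of a `k`-th power with no common prime factor are `k`-th powers. -/
lemma Plane.exists_eq_pow_of_mul_eq_pow {a b c : Plane} {k : ℕ} (hk : 0 < k) (ha : a ≠ 0)
    (hab : ∀ h, Prime h → h ∣ a → ¬ h ∣ b) (heq : a * b = c ^ k) :
    ∃ d e : Plane, a = d ^ k ∧ b = e ^ k := by
  let := UniqueFactorizationMonoid.toGCDMonoid Plane
  have hrel : IsRelPrime a b :=
    (UniqueFactorizationMonoid.isRelPrime_iff_no_prime_factors ha).mpr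
      fun d hda hdb hd => hab d hd hda hdb
  obtain ⟨d, hd⟩ := exists_associated_pow_of_mul_eq_pow (gcd_isUnit_iff_isRelPrime.mpr hrel) heq
  obtain ⟨e, he⟩ := exists_associated_pow_of_mul_eq_pow (gcd_isUnit_iff_isRelPrime.mpr hrel.symm)
    ((mul_comm b a).trans heq)
  obtain ⟨d', hd'⟩ := exists_eq_pow_of_associated hk hd
  obtain ⟨e', he'⟩ := exists_eq_pow_of_associated hk he
  exact ⟨d', e', hd', he'⟩

/-- Elements of `ℂ[u, v]` with equal `k`-th powers differ by a `k`-th root of unity. -/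
lemma Plane.exists_eq_smul_of_pow_eq_pow {a b : Plane} {k : ℕ} (hk : 0 < k) (hb : b ≠ 0)
    (h : a ^ k = b ^ k) : ∃ r : ℂ, r ^ k = 1 ∧ a = r • b := by
  obtain ⟨c, rfl⟩ : b ∣ a := (UniqueFactorizationMonoid.pow_dvd_pow_iff_dvd hk.ne').mp h.symm.dvd
  have hc : c ^ k = 1 := by
    rw [mul_pow] at h
    exact mul_left_cancel₀ (pow_ne_zero k hb) (h.trans (mul_one _).symm)
  obtain ⟨r, -, rfl⟩ := isUnit_iff_eq_C_of_isReduced.mp (IsUnit.of_pow_eq_one hc hk.ne')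
  refine ⟨r, ?_, by rw [smul_eq_C_mul, mul_comm]⟩
  rw [← C_pow] at hc
  exact C_injective _ _ (hc.trans C_1.symm)

/-- If a domain over `ℂ` contains `a` and `b` with `(ab)²` and `aᴺ + bᴺ` scalar, `N = 2m`, then
`a` is scalar. -/
lemma exists_eq_algebraMap_of_symmetric {Q : Type*} [CommRing Q] [IsDomain Q] [Algebra ℂ Q]
    {m : ℕ} (hm : 0 < m) {a b : Q} {c₁ c₂ : ℂ} (h₁ : (a * b) ^ 2 = algebraMap ℂ Q c₁)
    (h₂ : a ^ (2 * m) + b ^ (2 * m) = algebraMap ℂ Q c₂) : ∃ α, a = algebraMap ℂ Q α := by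
  have hprod : a ^ (2 * m) * b ^ (2 * m) = algebraMap ℂ Q (c₁ ^ m) := by
    rw [map_pow, ← h₁, ← mul_pow, pow_mul]
  have hint : IsIntegral ℂ (a ^ (2 * m)) := by
    refine ⟨Polynomial.X ^ 2 - Polynomial.C c₂ * Polynomial.X + Polynomial.C (c₁ ^ m), ?_, ?_⟩
    · monicity!
    · simp only [Polynomial.eval₂_add, Polynomial.eval₂_sub, Polynomial.eval₂_mul,
        Polynomial.eval₂_pow, Polynomial.eval₂_X, Polynomial.eval₂_C]
      rw [← hprod, ← h₂]
      ring
  have ha : IsIntegral ℂ a := hint.of_pow (by omega)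
  have hdeg := IsAlgClosed.degree_eq_one_of_irreducible ℂ (minpoly.irreducible ha)
  obtain ⟨α, hα⟩ := minpoly.mem_range_of_degree_eq_one ℂ a hdeg
  exact ⟨α, hα.symm⟩

lemma Plane.not_prime_dvd_X_sub_C {h : Plane} (hh : Prime h) {α β : ℂ} (h₀ : h ∣ X 0 - C α)
    (h₁ : h ∣ X 1 - C β) : False := by
  have hirr : Irreducible (X 0 - C α : Plane) := by
    have hdeg : (X 0 - C α : Plane).totalDegree = 1 := by
      rw [sub_eq_add_neg, ← C_neg, totalDegree_add_eq_left_of_totalDegree_lt] <;> simp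
    refine irreducible_of_totalDegree_eq_one hdeg fun x hx => ?_
    have := hx (Finsupp.single 0 1)
    rw [coeff_sub, coeff_C, if_neg (Finsupp.single_ne_zero.mpr one_ne_zero).symm] at this
    exact isUnit_of_dvd_one (by simpa using this)
  obtain ⟨k, hk⟩ := (hh.irreducible.associated_of_dvd hirr h₀).dvd_iff_dvd_left.mp h₁
  have := congrArg (eval ![α, β + 1]) hk
  simp at this

/-- The preimage of a point under the quotient map is not a curve, and automorphisms of `A` do not
change this. -/
lemma not_prime_dvd_quotientComorphism {m : ℕ} (hm : 0 < m) (φ : Adn (m + 2) ≃ₐ[ℂ] Adn (m + 2))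
    {h : Plane} (hh : Prime h)
    (hdvd : ∀ i, h ∣ quotientComorphism m (φ (Adn.gen (m + 2) i))) : False := by
  have hprime : (Ideal.span {h}).IsPrime := (Ideal.span_singleton_prime hh.ne_zero).mpr hh
  let π : Plane →ₐ[ℂ] Plane ⧸ Ideal.span {h} := Ideal.Quotient.mkₐ ℂ _
  have hscalar : ∀ a, ∃ c, π (quotientComorphism m a) = algebraMap ℂ _ c := by
    intro a
    obtain ⟨a, rfl⟩ := φ.surjective a
    obtain ⟨p, rfl⟩ := Ideal.Quotient.mk_surjective a
    refine ⟨aeval 0 p, ?_⟩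
    have : ((π.comp (quotientComorphism m)).comp φ.toAlgHom).comp (Ideal.Quotient.mkₐ ℂ _) =
        (Algebra.ofId ℂ _).comp (aeval (0 : Fin 3 → ℂ)) := by
      refine MvPolynomial.algHom_ext fun i => ?_
      have : π (quotientComorphism m (φ (Adn.gen (m + 2) i))) = 0 :=
        Ideal.Quotient.eq_zero_iff_mem.mpr (Ideal.mem_span_singleton.mpr (hdvd i))
      simpa using this
    exact DFunLike.congr_fun this p
  obtain ⟨c₁, h₁⟩ := hscalar (Adn.gen (m + 2) 0)
  obtain ⟨c₂, h₂⟩ := hscalar (Adn.gen (m + 2) 1)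
  rw [quotientComorphism_gen, map_dihedralInvariants] at h₁ h₂
  replace h₁ : (π (X 0) * π (X 1)) ^ 2 = algebraMap ℂ _ c₁ := h₁
  replace h₂ : π (X 0) ^ (2 * m) + π (X 1) ^ (2 * m) =
      algebraMap ℂ _ ((Complex.I / 2)⁻¹ * c₂) := by
    rw [map_mul, ← h₂, ← Algebra.smul_def]
    exact (inv_smul_smul₀ (by simp) _).symm
  have hmem : ∀ i α, π (X i) = algebraMap ℂ _ α → h ∣ X i - C α := by
    intro i α hi
    exact Ideal.mem_span_singleton.mp (Ideal.Quotient.eq.mp hi)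
  obtain ⟨α, hα⟩ := exists_eq_algebraMap_of_symmetric hm h₁ h₂
  rw [mul_comm] at h₁
  rw [add_comm] at h₂
  obtain ⟨β, hβ⟩ := exists_eq_algebraMap_of_symmetric hm h₁ h₂
  exact Plane.not_prime_dvd_X_sub_C hh (hmem 0 α hα) (hmem 1 β hβ)

/-- Solving `(U V)² = X`, etc., for a point `(X, Y, Z)` of the surface with values in `ℂ[u, v]`
whose coordinates have no common factor. -/
lemma exists_eq_dihedralInvariants {m : ℕ} (hm : 0 < m) {x y z : Plane} (hx : x ≠ 0)
    (hrel : x ^ (m + 1) + x * y ^ 2 + z ^ 2 = 0)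
    (hprime : ∀ h, Prime h → h ∣ x → h ∣ y → ¬ h ∣ z) :
    ∃ U V : Plane, x = dihedralInvariants m U V 0 ∧ y = dihedralInvariants m U V 1 ∧
      z = dihedralInvariants m U V 2 := by
  have hII : (C Complex.I : Plane) * C Complex.I = -1 := by
    rw [← C_mul, Complex.I_mul_I, C_neg, C_1]
  obtain ⟨W, T, hW, hT⟩ : ∃ W T : Plane, x = W ^ 2 ∧ -(x ^ m + y ^ 2) = T ^ 2 := by
    refine Plane.exists_eq_pow_of_mul_eq_pow (c := z) two_pos hx ?_ (by linear_combination -hrel)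
    intro h hh hdx hd
    have hy : h ∣ y := by
      refine hh.dvd_of_dvd_pow (n := 2) ?_
      have : y ^ 2 = -(-(x ^ m + y ^ 2)) - x ^ m := by ring
      rw [this]
      exact dvd_sub ((dvd_neg).mpr hd) (dvd_pow hdx hm.ne')
    refine hprime h hh hdx hy (hh.dvd_of_dvd_pow (n := 2) ?_)
    rw [show z ^ 2 = x * -(x ^ m + y ^ 2) by linear_combination hrel]
    exact hdx.mul_right _
  wlog hz : z = W * T generalizing T with H
  · refine H (-T) (by rw [hT]; ring) ?_
    have : z ^ 2 = (W * T) ^ 2 := by rw [mul_pow, ← hW, ← hT]; linear_combination hrel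
    rcases sq_eq_sq_iff_eq_or_eq_neg.mp this with h | h
    · exact absurd h hz
    · rw [h]; ring
  have hW0 : W ≠ 0 := by rintro rfl; simp at hW; exact hx hW
  have hprod : (T - C Complex.I * y) * -(T + C Complex.I * y) = W ^ (2 * m) := by
    rw [pow_mul, ← hW]
    linear_combination hT + y ^ 2 * hII
  obtain ⟨U, V, hU, hV⟩ : ∃ U V : Plane,
      T - C Complex.I * y = U ^ (2 * m) ∧ -(T + C Complex.I * y) = V ^ (2 * m) := by
    refine Plane.exists_eq_pow_of_mul_eq_pow (c := W) (by omega) ?_ ?_ hprod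
    · intro h
      rw [h, zero_mul] at hprod
      exact pow_ne_zero _ hW0 hprod.symm
    · intro h hh h₁ h₂
      have hhW : h ∣ W := hh.dvd_of_dvd_pow (hprod ▸ h₁.mul_right _)
      refine hprime h hh (hW ▸ dvd_pow hhW two_ne_zero) ?_ (hz ▸ hhW.mul_right _)
      have : y = C (Complex.I / 2) * ((T - C Complex.I * y) + -(T + C Complex.I * y)) := by
        have : (C (Complex.I / 2) : Plane) * 2 = C Complex.I := by
          rw [← map_ofNat C 2, ← C_mul, div_mul_cancel₀ _ two_ne_zero]
        linear_combination C Complex.I * y * this + y * hII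
      rw [this]
      exact (dvd_add h₁ h₂).mul_left _
  obtain ⟨r, hr, hUV⟩ := Plane.exists_eq_smul_of_pow_eq_pow (a := U * V) (b := W) (k := 2 * m)
    (by omega) hW0 (by rw [mul_pow, ← hU, ← hV, hprod])
  have hr0 : r ≠ 0 := by
    rintro rfl
    rw [zero_pow (by omega)] at hr
    exact zero_ne_one hr
  obtain ⟨U', hUV', hU'⟩ : ∃ U' : Plane, U' * V = W ∧ U' ^ (2 * m) = T - C Complex.I * y :=
    ⟨r⁻¹ • U, by rw [smul_mul_assoc, hUV, inv_smul_smul₀ hr0],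
      by rw [smul_pow, inv_pow, hr, inv_one, one_smul, hU]⟩
  refine ⟨U', V, ?_, ?_, ?_⟩ <;>
    simp only [dihedralInvariants, Matrix.cons_val_zero, Matrix.cons_val_one, Matrix.cons_val,
      hUV', hU', ← hV, smul_eq_C_mul]
  · exact hW
  · have : (C (Complex.I / 2) : Plane) * 2 = C Complex.I := by
      rw [← map_ofNat C 2, ← C_mul, div_mul_cancel₀ _ two_ne_zero]
    linear_combination C Complex.I * y * this + y * hII
  · have : (C (1 / 2) : Plane) * 2 = 1 := by
      rw [← map_ofNat C 2, ← C_mul, div_mul_cancel₀ _ two_ne_zero, C_1]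
    rw [hz]
    linear_combination -W * T * this

/-- Every automorphism of `A` lifts to an endomorphism of `ℂ[u, v]`. -/
lemma exists_lift {m : ℕ} (hm : 0 < m) (φ : Adn (m + 2) ≃ₐ[ℂ] Adn (m + 2)) :
    ∃ Φ : Plane →ₐ[ℂ] Plane,
      Φ.comp (quotientComorphism m) = (quotientComorphism m).comp φ.toAlgHom := by
  have hgen0 : Adn.gen (m + 2) 0 ≠ 0 := by
    intro h
    have := congrArg (quotientComorphism m) h
    rw [quotientComorphism_gen, map_zero] at this
    exact pow_ne_zero 2 (mul_ne_zero (X_ne_zero 0) (X_ne_zero 1)) this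
  obtain ⟨U, V, h₀, h₁, h₂⟩ := exists_eq_dihedralInvariants hm
    (x := quotientComorphism m (φ (Adn.gen (m + 2) 0)))
    (y := quotientComorphism m (φ (Adn.gen (m + 2) 1)))
    (z := quotientComorphism m (φ (Adn.gen (m + 2) 2)))
    (by
      rw [map_ne_zero_iff _ (quotientComorphism_injective hm), map_ne_zero_iff _ φ.injective]
      exact hgen0)
    (by
      have := congrArg (fun a => quotientComorphism m (φ a)) (Adn.relation m)
      simpa only [map_add, map_mul, map_pow, map_zero] using this)
    (fun h hh d₀ d₁ d₂ => not_prime_dvd_quotientComorphism hm φ hh fun i => by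
      fin_cases i
      exacts [d₀, d₁, d₂])
  refine ⟨aeval ![U, V], (comp_quotientComorphism_eq_iff _ _).mpr fun i => ?_⟩
  simp only [aeval_X]
  fin_cases i
  exacts [h₀, h₁, h₂]

namespace Plane

/-- An endomorphism of `ℂ[u, v]` is monomial if it rescales the variables, up to swapping them. -/
def IsMonomial (θ : Plane →ₐ[ℂ] Plane) : Prop :=
  ∃ r s : ℂ, r ≠ 0 ∧ s ≠ 0 ∧
    ((θ (X 0) = r • X 0 ∧ θ (X 1) = s • X 1) ∨ (θ (X 0) = r • X 1 ∧ θ (X 1) = s • X 0))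

lemma algHom_ext {S : Type*} [CommRing S] [Algebra ℂ S] {f g : Plane →ₐ[ℂ] S}
    (h₀ : f (X 0) = g (X 0)) (h₁ : f (X 1) = g (X 1)) : f = g :=
  MvPolynomial.algHom_ext (Fin.forall_fin_two.mpr ⟨h₀, h₁⟩)

lemma IsMonomial.bijective {θ : Plane →ₐ[ℂ] Plane} (hθ : IsMonomial θ) :
    Function.Bijective θ := by
  obtain ⟨r, s, hr, hs, ⟨h₀, h₁⟩ | ⟨h₀, h₁⟩⟩ := hθ
  · have e₁ : (aeval ![r⁻¹ • X 0, s⁻¹ • X 1] : Plane →ₐ[ℂ] Plane).comp θ = AlgHom.id ℂ _ :=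
      algHom_ext (by simp [h₀, hr]) (by simp [h₁, hs])
    have e₂ : θ.comp (aeval ![r⁻¹ • X 0, s⁻¹ • X 1] : Plane →ₐ[ℂ] Plane) = AlgHom.id ℂ _ :=
      algHom_ext (by simp [h₀, hr]) (by simp [h₁, hs])
    exact (AlgEquiv.ofAlgHom θ _ e₂ e₁).bijective
  · have e₁ : (aeval ![s⁻¹ • X 1, r⁻¹ • X 0] : Plane →ₐ[ℂ] Plane).comp θ = AlgHom.id ℂ _ :=
      algHom_ext (by simp [h₀, hr]) (by simp [h₁, hs])
    have e₂ : θ.comp (aeval ![s⁻¹ • X 1, r⁻¹ • X 0] : Plane →ₐ[ℂ] Plane) = AlgHom.id ℂ _ :=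
      algHom_ext (by simp [h₁, hs]) (by simp [h₀, hr])
    exact (AlgEquiv.ofAlgHom θ _ e₂ e₁).bijective

lemma IsMonomial.aeval_zero {θ : Plane →ₐ[ℂ] Plane} (hθ : IsMonomial θ) (p : Plane) :
    aeval (0 : Fin 2 → ℂ) (θ p) = aeval (0 : Fin 2 → ℂ) p := by
  have : (aeval (0 : Fin 2 → ℂ)).comp θ = aeval (0 : Fin 2 → ℂ) := by
    obtain ⟨r, s, -, -, ⟨h₀, h₁⟩ | ⟨h₀, h₁⟩⟩ := hθ <;>
      exact algHom_ext (by simp [h₀]) (by simp [h₁])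
  exact DFunLike.congr_fun this p

end Plane

open Plane

/-- Endomorphisms of `ℂ[u, v]` over `A` are monomial. -/
lemma isMonomial_of_comp_quotientComorphism {m : ℕ} (hm : 0 < m) {θ : Plane →ₐ[ℂ] Plane}
    (hθ : θ.comp (quotientComorphism m) = quotientComorphism m) : IsMonomial θ := by
  have h := (comp_quotientComorphism_eq_iff θ _).mp hθ
  have h₀ := h 0
  have h₁ := h 1
  rw [quotientComorphism_gen] at h₀ h₁
  replace h₀ : (X 0 * X 1 : Plane) ^ 2 = (θ (X 0) * θ (X 1)) ^ 2 := h₀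
  replace h₁ : (X 0 ^ (2 * m) + X 1 ^ (2 * m) : Plane) = θ (X 0) ^ (2 * m) + θ (X 1) ^ (2 * m) :=
    smul_right_injective _ (by simp : Complex.I / 2 ≠ 0) h₁
  replace h₀ := congrArg (· ^ m) h₀
  simp only [← pow_mul] at h₀
  rw [mul_pow, mul_pow] at h₀
  have hm2 : 0 < 2 * m := by omega
  have hne : ∀ {r : ℂ}, r ^ (2 * m) = 1 → r ≠ 0 := by
    rintro r hr rfl
    rw [zero_pow hm2.ne'] at hr
    exact zero_ne_one hr
  have key : (θ (X 0) ^ (2 * m) - X 0 ^ (2 * m)) * (θ (X 0) ^ (2 * m) - X 1 ^ (2 * m)) = 0 := by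
    linear_combination h₀ - θ (X 0) ^ (2 * m) * h₁
  rcases mul_eq_zero.mp key with hp | hp
  · obtain ⟨r, hr, hr'⟩ := exists_eq_smul_of_pow_eq_pow hm2 (X_ne_zero 0) (sub_eq_zero.mp hp)
    obtain ⟨s, hs, hs'⟩ := exists_eq_smul_of_pow_eq_pow (a := θ (X 1)) hm2 (X_ne_zero 1)
      (by linear_combination -h₁ - hp)
    exact ⟨r, s, hne hr, hne hs, Or.inl ⟨hr', hs'⟩⟩
  · obtain ⟨r, hr, hr'⟩ := exists_eq_smul_of_pow_eq_pow hm2 (X_ne_zero 1) (sub_eq_zero.mp hp)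
    obtain ⟨s, hs, hs'⟩ := exists_eq_smul_of_pow_eq_pow (a := θ (X 1)) hm2 (X_ne_zero 0)
      (by linear_combination -h₁ - hp)
    exact ⟨r, s, hne hr, hne hs, Or.inr ⟨hr', hs'⟩⟩

/-- Every automorphism of `A` lifts to an automorphism of `ℂ[u, v]`. -/
lemma exists_lift_equiv {m : ℕ} (hm : 0 < m) (φ : Adn (m + 2) ≃ₐ[ℂ] Adn (m + 2)) :
    ∃ Φ : Plane ≃ₐ[ℂ] Plane, ∀ a, Φ (quotientComorphism m a) = quotientComorphism m (φ a) := by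
  obtain ⟨Φ, hΦ⟩ := exists_lift hm φ
  obtain ⟨Ψ, hΨ⟩ := exists_lift hm φ.symm
  replace hΦ : ∀ a, Φ (quotientComorphism m a) = quotientComorphism m (φ a) :=
    DFunLike.congr_fun hΦ
  replace hΨ : ∀ a, Ψ (quotientComorphism m a) = quotientComorphism m (φ.symm a) :=
    DFunLike.congr_fun hΨ
  have h₁ : IsMonomial (Φ.comp Ψ) :=
    isMonomial_of_comp_quotientComorphism hm (AlgHom.ext fun a => by simp [hΦ, hΨ])
  have h₂ : IsMonomial (Ψ.comp Φ) :=
    isMonomial_of_comp_quotientComorphism hm (AlgHom.ext fun a => by simp [hΦ, hΨ])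
  refine ⟨AlgEquiv.ofBijective Φ ⟨?_, ?_⟩, hΦ⟩
  · exact Function.Injective.of_comp (f := Ψ) h₂.bijective.1
  · exact Function.Surjective.of_comp (g := Ψ) h₁.bijective.2

/-- A lift of an automorphism of `A` normalizes the group of automorphisms of `ℂ[u, v]` over `A`. -/
lemma exists_isMonomial_conj {m : ℕ} (hm : 0 < m) {φ : Adn (m + 2) ≃ₐ[ℂ] Adn (m + 2)}
    {Φ : Plane ≃ₐ[ℂ] Plane}
    (hΦ : ∀ a, Φ (quotientComorphism m a) = quotientComorphism m (φ a)) {g : Plane →ₐ[ℂ] Plane}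
    (hg : g.comp (quotientComorphism m) = quotientComorphism m) :
    ∃ θ, IsMonomial θ ∧ ∀ p, θ (Φ p) = Φ (g p) := by
  refine ⟨(Φ.toAlgHom.comp g).comp Φ.symm.toAlgHom, ?_, fun p => by simp⟩
  refine isMonomial_of_comp_quotientComorphism hm (AlgHom.ext fun a => ?_)
  have hsymm : Φ.symm (quotientComorphism m a) = quotientComorphism m (φ.symm a) := by
    rw [AlgEquiv.symm_apply_eq, hΦ, AlgEquiv.apply_symm_apply]
  have := DFunLike.congr_fun hg (φ.symm a)
  rw [AlgHom.comp_apply] at this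
  simp [hsymm, this, hΦ]

/-- The action of `diag(ζ, ζ⁻¹)` on `ℂ[u, v]`. -/
def diagRotation (ζ : ℂ) : Plane →ₐ[ℂ] Plane := aeval ![ζ • X 0, ζ⁻¹ • X 1]

/-- The action `u ↦ v`, `v ↦ -u` on `ℂ[u, v]`. -/
def quarterTurn : Plane →ₐ[ℂ] Plane := aeval ![X 1, -X 0]

lemma diagRotation_comp_quotientComorphism {m : ℕ} {ζ : ℂ} (h0 : ζ ≠ 0) (hζ : ζ ^ (2 * m) = 1) :
    (diagRotation ζ).comp (quotientComorphism m) = quotientComorphism m := by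
  refine (comp_quotientComorphism_eq_iff _ _).mpr fun i => ?_
  rw [quotientComorphism_gen]
  have hr₀ : diagRotation ζ (X 0) = ζ • X 0 := aeval_X _ 0
  have hr₁ : diagRotation ζ (X 1) = ζ⁻¹ • X 1 := aeval_X _ 1
  simp only [dihedralInvariants, hr₀, hr₁, smul_pow, inv_pow, hζ, smul_mul_smul_comm,
    mul_inv_cancel₀ h0, one_smul, inv_one]

lemma quarterTurn_comp_quotientComorphism (m : ℕ) :
    quarterTurn.comp (quotientComorphism m) = quotientComorphism m := by
  refine (comp_quotientComorphism_eq_iff _ _).mpr fun i => ?_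
  rw [quotientComorphism_gen]
  have hr₀ : quarterTurn (X 0) = X 1 := aeval_X _ 0
  have hr₁ : quarterTurn (X 1) = -X 0 := aeval_X _ 1
  have heven : (-X 0 : Plane) ^ (2 * m) = X 0 ^ (2 * m) := (even_two_mul m).neg_pow _
  fin_cases i
  · simp [dihedralInvariants, hr₀, hr₁, mul_comm]
  · simp [dihedralInvariants, hr₀, hr₁, add_comm]
  · simp only [dihedralInvariants, hr₀, hr₁, heven, Fin.reduceFinMk, Matrix.cons_val]
    congr 1
    ring

lemma MvPolynomial.IsHomogeneous.aeval_mul {σ S : Type*} [Fintype σ] [CommRing S] [Algebra ℂ S]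
    {Q : MvPolynomial σ ℂ} {k : ℕ} (hQ : Q.IsHomogeneous k) (c : S) (f : σ → S) :
    MvPolynomial.aeval (fun i => c * f i) Q = c ^ k * MvPolynomial.aeval f Q := by
  rw [aeval_def, aeval_def, eval₂_eq', eval₂_eq', Finset.mul_sum]
  refine Finset.sum_congr rfl fun s hs => ?_
  have hdeg : ∑ i, s i = k := by
    rw [← Finsupp.degree_eq_sum]
    exact (hQ.degree_eq_sum_deg_support hs).symm
  simp only [mul_pow, Finset.prod_mul_distrib, Finset.prod_pow_eq_pow_sum, hdeg]
  ring

lemma MvPolynomial.homogeneousComponent_totalDegree_ne_zero {σ R : Type*} [CommSemiring R]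
    {P : MvPolynomial σ R} (hP : P ≠ 0) : homogeneousComponent P.totalDegree P ≠ 0 := by
  obtain ⟨s, hs, hdeg⟩ := Finset.exists_mem_eq_sup P.support
    (support_nonempty.mpr hP) (fun s => s.degree)
  intro h
  have hcoeff := coeff_homogeneousComponent P.totalDegree P s
  have htot : P.totalDegree = s.degree := hdeg
  rw [h, htot, if_pos rfl, coeff_zero] at hcoeff
  exact mem_support_iff.mp hs hcoeff.symm

namespace Plane

/-- Linearly independent elements of `ℂ[u, v]` satisfy no homogeneous algebraic relation. -/
lemma eq_zero_of_aeval_eq_zero_of_isHomogeneous {F G : Plane}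
    (hFG : ∀ a b : ℂ, a • F + b • G = 0 → a = 0 ∧ b = 0) {Q : Plane} {k : ℕ}
    (hQ : Q.IsHomogeneous k) (h : aeval ![F, G] Q = 0) : Q = 0 := by
  have hG : G ≠ 0 := by
    rintro rfl
    exact one_ne_zero (hFG 0 1 (by simp)).2
  let K := FractionRing Plane
  let j : Plane →ₐ[ℂ] K := IsScalarTower.toAlgHom ℂ Plane K
  have hj : Function.Injective j := IsFractionRing.injective Plane K
  have hjG : j G ≠ 0 := (map_ne_zero_iff j hj).mpr hG
  let q : Polynomial ℂ := aeval ![Polynomial.X, 1] Q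
  have hdehom : ∀ {S : Type} [CommRing S] [Algebra ℂ S] (t : S),
      Polynomial.aeval t q = aeval ![t, 1] Q := by
    intro S _ _ t
    have : (Polynomial.aeval t).comp (aeval ![(Polynomial.X : Polynomial ℂ), 1]) =
        (aeval ![t, 1] : Plane →ₐ[ℂ] S) := algHom_ext (by simp) (by simp)
    exact DFunLike.congr_fun this Q
  have hq : q = 0 := by
    by_contra hq
    have hroot : Polynomial.aeval (j F / j G) q = 0 := by
      rw [hdehom]
      refine (mul_eq_zero.mp (?_ : j G ^ k * _ = 0)).resolve_left (pow_ne_zero k hjG)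
      rw [← hQ.aeval_mul]
      have : (aeval fun i => j G * (![j F / j G, 1] : Fin 2 → K) i) =
          j.comp (aeval ![F, G] : Plane →ₐ[ℂ] Plane) :=
        algHom_ext (by simp [mul_div_cancel₀ _ hjG]) (by simp)
      rw [this, AlgHom.comp_apply, h, map_zero]
    have halg : IsIntegral ℂ (j F / j G) := IsAlgebraic.isIntegral ⟨q, hq, hroot⟩
    have hdeg := IsAlgClosed.degree_eq_one_of_irreducible ℂ (minpoly.irreducible halg)
    obtain ⟨c, hc⟩ := minpoly.mem_range_of_degree_eq_one ℂ _ hdeg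
    have hF : F = c • G := by
      refine hj ?_
      rw [map_smul, Algebra.smul_def, hc, div_mul_cancel₀ _ hjG]
    exact one_ne_zero (hFG 1 (-c) (by rw [hF]; simp)).1
  have key : X 1 * Q = 0 := by
    refine MvPolynomial.funext fun w => ?_
    rw [map_mul, eval_X, map_zero]
    by_cases hw : w 1 = 0
    · rw [hw, zero_mul]
    · have hw' : w = fun i => w 1 * (![w 0 / w 1, 1] : Fin 2 → ℂ) i := by
        funext i
        fin_cases i
        · simp [mul_div_cancel₀ _ hw]
        · simp
      rw [← coe_aeval_eq_eval, RingHom.coe_coe]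
      conv_lhs => rw [hw']
      rw [hQ.aeval_mul, ← hdehom, hq, map_zero, mul_zero, mul_zero]
  exact (mul_eq_zero.mp key).resolve_left (X_ne_zero 1)

/-- The homomorphism `p ↦ ∑ pⱼ tʲ`, where `pⱼ` is the homogeneous component of degree `j`. -/
def dilate : Plane →ₐ[ℂ] Polynomial Plane := aeval fun i => Polynomial.C (X i) * Polynomial.X

lemma coeff_dilate (p : Plane) (j : ℕ) : (dilate p).coeff j = homogeneousComponent j p := by
  induction p using MvPolynomial.induction_on' with
  | monomial s a =>
    have : dilate (monomial s a) = Polynomial.C (monomial s a) * Polynomial.X ^ s.degree := by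
      rw [dilate, aeval_monomial, Finsupp.prod_fintype _ _ (by simp), monomial_eq,
        Finsupp.prod_fintype _ _ (by simp), Finsupp.degree_eq_sum]
      simp only [Fin.prod_univ_two, Fin.sum_univ_two, map_mul, map_pow]
      have : algebraMap ℂ (Polynomial Plane) a = Polynomial.C (C a) := rfl
      rw [this]
      ring
    rw [this, Polynomial.coeff_C_mul_X_pow,
      homogeneousComponent_of_mem (isHomogeneous_monomial a rfl)]
  | add p q hp hq => rw [map_add, Polynomial.coeff_add, hp, hq, map_add]

lemma eval_one_dilate (p : Plane) : (dilate p).eval 1 = p := by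
  have : ((Polynomial.aeval (1 : Plane)).restrictScalars ℂ).comp dilate = AlgHom.id ℂ Plane :=
    algHom_ext (by simp [dilate]) (by simp [dilate])
  simpa [Polynomial.coe_aeval_eq_eval] using DFunLike.congr_fun this p

/-- The space of polynomials of total degree at most `k`. -/
def degreeLE (k : ℕ) : Submodule ℂ Plane where
  carrier := {p | (dilate p).natDegree ≤ k}
  add_mem' := fun {p q} hp hq => by
    rw [Set.mem_ofPred_eq, map_add]
    exact Polynomial.natDegree_add_le_of_degree_le hp hq
  zero_mem' := by simp
  smul_mem' := fun c p hp => by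
    rw [Set.mem_ofPred_eq, map_smul]
    exact (Polynomial.natDegree_smul_le c _).trans hp

lemma mem_degreeLE {k : ℕ} {p : Plane} : p ∈ degreeLE k ↔ (dilate p).natDegree ≤ k := Iff.rfl

lemma IsMonomial.map_mem_degreeLE {θ : Plane →ₐ[ℂ] Plane} (hθ : IsMonomial θ) {k : ℕ} {p : Plane}
    (hp : p ∈ degreeLE k) : θ p ∈ degreeLE k := by
  have : dilate.comp θ = (Polynomial.mapAlgHom θ).comp dilate := by
    obtain ⟨r, s, -, -, ⟨h₀, h₁⟩ | ⟨h₀, h₁⟩⟩ := hθ <;>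
      refine algHom_ext ?_ ?_ <;> simp [dilate, h₀, h₁, smul_eq_C_mul, mul_assoc]
  have h : dilate (θ p) = (dilate p).map (θ : Plane →+* Plane) := DFunLike.congr_fun this p
  rw [mem_degreeLE, h]
  exact Polynomial.natDegree_map_le.trans hp

lemma exists_eq_of_mem_degreeLE_one {p : Plane} (hp : p ∈ degreeLE 1) :
    ∃ c a b : ℂ, p = C c + (a • X 0 + b • X 1) := by
  have h : p = homogeneousComponent 0 p + homogeneousComponent 1 p := by
    conv_lhs => rw [← eval_one_dilate p, Polynomial.eq_X_add_C_of_natDegree_le_one hp]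
    simp [coeff_dilate, -homogeneousComponent_zero, add_comm]
  have h₁ : homogeneousComponent 1 p ∈ homogeneousSubmodule (Fin 2) ℂ 1 :=
    homogeneousComponent_isHomogeneous 1 p
  rw [homogeneousSubmodule_one_eq_span_X, Submodule.mem_span_range_iff_exists_fun] at h₁
  obtain ⟨c, hc⟩ := h₁
  rw [Fin.sum_univ_two] at hc
  exact ⟨coeff 0 p, c 0, c 1, by rw [hc, ← homogeneousComponent_zero, ← h]⟩

/-- The leading form of `P(U, V)` when `U` and `V` have degree at most `d`. -/
lemma coeff_dilate_aeval {d : ℕ} (hd : 0 < d) {U V : Plane} (hU : U ∈ degreeLE d)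
    (hV : V ∈ degreeLE d) (P : Plane) :
    (dilate (aeval ![U, V] P)).coeff (d * P.totalDegree) =
      aeval ![(dilate U).coeff d, (dilate V).coeff d] (homogeneousComponent P.totalDegree P) := by
  have hcomp : dilate (aeval ![U, V] P) = aeval ![dilate U, dilate V] P := by
    have : dilate.comp (aeval ![U, V] : Plane →ₐ[ℂ] Plane) = aeval ![dilate U, dilate V] :=
      algHom_ext (by simp) (by simp)
    exact DFunLike.congr_fun this P
  rw [hcomp, aeval_def, eval₂_eq', Polynomial.finsetSum_coeff, homogeneousComponent_apply,
    map_sum, Finset.sum_filter]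
  refine Finset.sum_congr rfl fun s hs => ?_
  have halg : algebraMap ℂ (Polynomial Plane) (coeff s P) = Polynomial.C (C (coeff s P)) := rfl
  have hU' := Polynomial.natDegree_pow_le_of_le (s 0) hU
  have hV' := Polynomial.natDegree_pow_le_of_le (s 1) hV
  have hdeg : s.degree = s 0 + s 1 := by rw [Finsupp.degree_eq_sum, Fin.sum_univ_two]
  simp only [Fin.prod_univ_two, Matrix.cons_val_zero, Matrix.cons_val_one]
  rw [halg, Polynomial.coeff_C_mul]
  split_ifs with h
  · rw [aeval_monomial, Finsupp.prod_fintype _ _ (by simp), Fin.prod_univ_two, ← h, hdeg,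
      show d * (s 0 + s 1) = s 0 * d + s 1 * d by ring,
      Polynomial.coeff_mul_add_eq_of_natDegree_le hU' hV',
      Polynomial.coeff_pow_of_natDegree_le hU,
      Polynomial.coeff_pow_of_natDegree_le hV]
    rfl
  · have hlt : s.degree < P.totalDegree := lt_of_le_of_ne (le_totalDegree hs) h
    rw [Polynomial.coeff_eq_zero_of_natDegree_lt, mul_zero]
    refine (Polynomial.natDegree_mul_le_of_le hU' hV').trans_lt ?_
    calc s 0 * d + s 1 * d = d * s.degree := by rw [hdeg]; ring
      _ < d * P.totalDegree := Nat.mul_lt_mul_of_pos_left hlt hd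

/-- An automorphism of `ℂ[u, v]` with all non-zero combinations of the images of `u` and `v` of the
same degree `d` is affine. -/
lemma le_one_of_linearIndependent {d : ℕ} (Φ : Plane ≃ₐ[ℂ] Plane) (hU : Φ (X 0) ∈ degreeLE d)
    (hV : Φ (X 1) ∈ degreeLE d)
    (hFG : ∀ a b : ℂ, a • (dilate (Φ (X 0))).coeff d + b • (dilate (Φ (X 1))).coeff d = 0 →
      a = 0 ∧ b = 0) : d ≤ 1 := by
  rcases Nat.eq_zero_or_pos d with rfl | hd
  · exact zero_le_one
  have hP : aeval ![Φ (X 0), Φ (X 1)] (Φ.symm (X 0)) = X 0 := by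
    have : aeval ![Φ (X 0), Φ (X 1)] = Φ.toAlgHom := algHom_ext (by simp) (by simp)
    rw [this]
    simp
  have hcoeff := coeff_dilate_aeval hd hU hV (Φ.symm (X 0))
  rw [hP] at hcoeff
  have hne : (dilate (X 0)).coeff (d * (Φ.symm (X 0)).totalDegree) ≠ 0 := by
    rw [hcoeff]
    intro h
    refine homogeneousComponent_totalDegree_ne_zero ?_
      (eq_zero_of_aeval_eq_zero_of_isHomogeneous hFG (homogeneousComponent_isHomogeneous _ _) h)
    rw [ne_eq, EmbeddingLike.map_eq_zero_iff]
    exact X_ne_zero 0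
  rw [dilate, aeval_X, Polynomial.coeff_C_mul_X] at hne
  have : d * (Φ.symm (X 0)).totalDegree = 1 := by
    by_contra h
    exact hne (if_neg h)
  exact (Nat.eq_one_of_mul_eq_one_right this).le

end Plane

section Lift

variable {m : ℕ} {φ : Adn (m + 2) ≃ₐ[ℂ] Adn (m + 2)} {Φ : Plane ≃ₐ[ℂ] Plane}

/-- The group of automorphisms over `A` acts irreducibly on the span of `u` and `v`, hence on the
span of their images under a lift. -/
lemma lift_mem_degreeLE (hm : 2 ≤ m)
    (hΦ : ∀ a, Φ (quotientComorphism m a) = quotientComorphism m (φ a)) {k : ℕ} {a b : ℂ}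
    (hab : ¬ (a = 0 ∧ b = 0)) (h : Φ (a • X 0 + b • X 1) ∈ degreeLE k) :
    Φ (X 0) ∈ degreeLE k ∧ Φ (X 1) ∈ degreeLE k := by
  have hm0 : 0 < m := by omega
  have hζ := Complex.isPrimitiveRoot_exp (2 * m) (by omega)
  generalize Complex.exp (2 * Real.pi * Complex.I / (2 * m : ℕ)) = ζ at hζ
  have hζ0 : ζ ≠ 0 := hζ.ne_zero (by omega)
  have hζ2 : ζ⁻¹ - ζ ≠ 0 := by
    intro h0
    have : ζ ^ 2 = 1 := by
      field_simp at h0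
      linear_combination -h0
    have := Nat.le_of_dvd two_pos ((hζ.pow_eq_one_iff_dvd 2).mp this)
    omega
  obtain ⟨θ, hθ, hθΦ⟩ := exists_isMonomial_conj hm0 hΦ
    (diagRotation_comp_quotientComorphism hζ0 hζ.pow_eq_one)
  obtain ⟨τ, hτ, hτΦ⟩ := exists_isMonomial_conj hm0 hΦ (quarterTurn_comp_quotientComorphism m)
  have hUV : Φ (X 0) ∈ degreeLE k → Φ (X 1) ∈ degreeLE k := by
    intro hU
    simpa [hτΦ, quarterTurn] using hτ.map_mem_degreeLE hU
  have hVU : Φ (X 1) ∈ degreeLE k → Φ (X 0) ∈ degreeLE k := by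
    intro hV
    simpa [hτΦ, quarterTurn] using hτ.map_mem_degreeLE hV
  by_cases hb : b = 0
  · have ha : a ≠ 0 := fun ha => hab ⟨ha, hb⟩
    rw [hb, zero_smul, add_zero, map_smul] at h
    have hU := ((degreeLE k).smul_mem_iff ha).mp h
    exact ⟨hU, hUV hU⟩
  · have hdiff := (degreeLE k).sub_mem (hθ.map_mem_degreeLE h) ((degreeLE k).smul_mem ζ h)
    have heq : θ (Φ (a • X 0 + b • X 1)) - ζ • Φ (a • X 0 + b • X 1) =
        (b * (ζ⁻¹ - ζ)) • Φ (X 1) := by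
      rw [hθΦ, ← map_smul, ← map_sub, ← map_smul]
      congr 1
      simp only [diagRotation, map_add, map_smul, aeval_X, Matrix.cons_val_zero,
        Matrix.cons_val_one]
      module
    rw [heq] at hdiff
    have hV := ((degreeLE k).smul_mem_iff (mul_ne_zero hb hζ2)).mp hdiff
    exact ⟨hVU hV, hV⟩

lemma lift_mem_degreeLE_one (hm : 2 ≤ m)
    (hΦ : ∀ a, Φ (quotientComorphism m a) = quotientComorphism m (φ a)) :
    Φ (X 0) ∈ degreeLE 1 ∧ Φ (X 1) ∈ degreeLE 1 := by
  obtain ⟨d, hd⟩ : ∃ d, d = max (dilate (Φ (X 0))).natDegree (dilate (Φ (X 1))).natDegree :=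
    ⟨_, rfl⟩
  have hU : Φ (X 0) ∈ degreeLE d := by rw [mem_degreeLE, hd]; exact le_max_left _ _
  have hV : Φ (X 1) ∈ degreeLE d := by rw [mem_degreeLE, hd]; exact le_max_right _ _
  by_cases hd1 : d ≤ 1
  · exact ⟨le_trans hU hd1, le_trans hV hd1⟩
  · refine absurd (le_one_of_linearIndependent Φ hU hV fun a b hab => ?_) hd1
    by_contra hne
    have hmem : Φ (a • X 0 + b • X 1) ∈ degreeLE (d - 1) := by
      rw [map_add, map_smul, map_smul]
      refine Polynomial.natDegree_le_pred
        ((degreeLE d).add_mem ((degreeLE d).smul_mem a hU) ((degreeLE d).smul_mem b hV)) ?_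
      rw [map_add, map_smul, map_smul, Polynomial.coeff_add, Polynomial.coeff_smul,
        Polynomial.coeff_smul, hab]
    obtain ⟨h₀, h₁⟩ := lift_mem_degreeLE hm hΦ hne hmem
    have := max_le (mem_degreeLE.mp h₀) (mem_degreeLE.mp h₁)
    omega

/-- The lift of an automorphism of `A` fixes the origin. -/
lemma aeval_zero_lift (hm : 0 < m)
    (hΦ : ∀ a, Φ (quotientComorphism m a) = quotientComorphism m (φ a)) :
    aeval (0 : Fin 2 → ℂ) (Φ (X 0)) = 0 ∧ aeval (0 : Fin 2 → ℂ) (Φ (X 1)) = 0 := by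
  obtain ⟨τ, hτ, hτΦ⟩ := exists_isMonomial_conj hm hΦ (quarterTurn_comp_quotientComorphism m)
  have h₀ := hτ.aeval_zero (Φ (X 0))
  have h₁ := hτ.aeval_zero (Φ (X 1))
  have e₀ : quarterTurn (X 0) = X 1 := aeval_X _ 0
  have e₁ : quarterTurn (X 1) = -X 0 := aeval_X _ 1
  rw [hτΦ, e₀] at h₀
  rw [hτΦ, e₁, map_neg, map_neg] at h₁
  constructor
  · linear_combination (-1 / 2) * (h₀ + h₁)
  · linear_combination (1 / 2) * (h₀ - h₁)

lemma smul_X_add_smul_X_inj {a b a' b' : ℂ}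
    (h : (a • X 0 + b • X 1 : Plane) = a' • X 0 + b' • X 1) : a = a' ∧ b = b' := by
  constructor
  · simpa using congrArg (eval ![1, 0]) h
  · simpa using congrArg (eval ![0, 1]) h

/-- Lifts of automorphisms of `A` are monomial. -/
lemma isMonomial_lift (hm : 3 ≤ m)
    (hΦ : ∀ a, Φ (quotientComorphism m a) = quotientComorphism m (φ a)) :
    IsMonomial Φ.toAlgHom := by
  have hm0 : 0 < m := by omega
  obtain ⟨hU, hV⟩ := lift_mem_degreeLE_one (by omega) hΦ
  obtain ⟨hU0, hV0⟩ := aeval_zero_lift hm0 hΦ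
  obtain ⟨c, α, β, hU⟩ := exists_eq_of_mem_degreeLE_one hU
  obtain ⟨c', γ, δ, hV⟩ := exists_eq_of_mem_degreeLE_one hV
  obtain rfl : c = 0 := by simpa [hU] using hU0
  obtain rfl : c' = 0 := by simpa [hV] using hV0
  rw [C_0, zero_add] at hU hV
  have hαβ : ¬ (α = 0 ∧ β = 0) := by
    rintro ⟨rfl, rfl⟩
    simp [X_ne_zero] at hU
  have hγδ : ¬ (γ = 0 ∧ δ = 0) := by
    rintro ⟨rfl, rfl⟩
    simp [X_ne_zero] at hV
  have hζ := Complex.isPrimitiveRoot_exp (2 * m) (by omega)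
  generalize Complex.exp (2 * Real.pi * Complex.I / (2 * m : ℕ)) = ζ at hζ
  have hζ0 : ζ ≠ 0 := hζ.ne_zero (by omega)
  have hζ4 : ζ ^ 4 ≠ 1 := fun h => by
    have := Nat.le_of_dvd (by norm_num) ((hζ.pow_eq_one_iff_dvd 4).mp h)
    omega
  have hinv : ζ ≠ ζ⁻¹ := fun h => hζ4 <| by
    have : ζ * ζ = 1 := by nth_rw 2 [h]; exact mul_inv_cancel₀ hζ0
    linear_combination (ζ ^ 2 + 1) * this
  obtain ⟨θ, ⟨r, s, hr, hs, hθ⟩, hθΦ⟩ := exists_isMonomial_conj hm0 hΦ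
    (diagRotation_comp_quotientComorphism hζ0 hζ.pow_eq_one)
  have e₀ : θ (Φ (X 0)) = ζ • Φ (X 0) := by
    rw [hθΦ, ← map_smul]
    congr 1
    exact aeval_X _ 0
  have e₁ : θ (Φ (X 1)) = ζ⁻¹ • Φ (X 1) := by
    rw [hθΦ, ← map_smul]
    congr 1
    exact aeval_X _ 1
  rw [hU, map_add, map_smul, map_smul, smul_add, smul_smul, smul_smul] at e₀
  rw [hV, map_add, map_smul, map_smul, smul_add, smul_smul, smul_smul] at e₁
  rcases hθ with ⟨h₀, h₁⟩ | ⟨h₀, h₁⟩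
  · rw [h₀, h₁, smul_smul, smul_smul] at e₀ e₁
    obtain ⟨hα, hβ⟩ := smul_X_add_smul_X_inj e₀
    obtain ⟨hγ, hδ⟩ := smul_X_add_smul_X_inj e₁
    by_cases hα0 : α = 0
    · have hβ0 : β ≠ 0 := fun h => hαβ ⟨hα0, h⟩
      have hsζ : s = ζ := mul_left_cancel₀ hβ0 (hβ.trans (mul_comm _ _))
      have hδ0 : δ = 0 := by
        by_contra h
        exact hinv (hsζ.symm.trans (mul_left_cancel₀ h (hδ.trans (mul_comm _ _))))
      refine ⟨β, γ, hβ0, fun h => hγδ ⟨h, hδ0⟩, Or.inr ⟨?_, ?_⟩⟩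
      · simp [hU, hα0]
      · simp [hV, hδ0]
    · have hrζ : r = ζ := mul_left_cancel₀ hα0 (hα.trans (mul_comm _ _))
      have hγ0 : γ = 0 := by
        by_contra h
        exact hinv (hrζ.symm.trans (mul_left_cancel₀ h (hγ.trans (mul_comm _ _))))
      have hδ0 : δ ≠ 0 := fun h => hγδ ⟨hγ0, h⟩
      have hsζ : s = ζ⁻¹ := mul_left_cancel₀ hδ0 (hδ.trans (mul_comm _ _))
      have hβ0 : β = 0 := by
        by_contra h
        exact hinv ((mul_left_cancel₀ h (hβ.trans (mul_comm _ _))).symm.trans hsζ)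
      refine ⟨α, δ, hα0, hδ0, Or.inl ⟨?_, ?_⟩⟩
      · simp [hU, hβ0]
      · simp [hV, hγ0]
  · rw [h₀, h₁, smul_smul, smul_smul, add_comm] at e₀ e₁
    obtain ⟨hα, hβ⟩ := smul_X_add_smul_X_inj e₀
    obtain ⟨hγ, hδ⟩ := smul_X_add_smul_X_inj e₁
    have hrs : r * s = ζ ^ 2 := by
      by_cases hα0 : α = 0
      · have hβ0 : β ≠ 0 := fun h => hαβ ⟨hα0, h⟩
        exact mul_left_cancel₀ hβ0 (by linear_combination r * hα + ζ * hβ)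
      · exact mul_left_cancel₀ hα0 (by linear_combination s * hβ + ζ * hα)
    have hrs' : r * s = ζ⁻¹ ^ 2 := by
      by_cases hγ0 : γ = 0
      · have hδ0 : δ ≠ 0 := fun h => hγδ ⟨hγ0, h⟩
        exact mul_left_cancel₀ hδ0 (by linear_combination r * hγ + ζ⁻¹ * hδ)
      · exact mul_left_cancel₀ hγ0 (by linear_combination s * hδ + ζ⁻¹ * hγ)
    refine absurd ?_ hζ4
    have h := hrs.symm.trans hrs'
    field_simp at h
    linear_combination h

/-- The scalars of a monomial lift agree up to a `2m`-th root of unity. -/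
lemma pow_eq_pow_of_lift (hm : 0 < m)
    (hΦ : ∀ a, Φ (quotientComorphism m a) = quotientComorphism m (φ a)) {r s : ℂ}
    (h : (Φ (X 0) = r • X 0 ∧ Φ (X 1) = s • X 1) ∨ (Φ (X 0) = r • X 1 ∧ Φ (X 1) = s • X 0)) :
    r ^ (2 * m) = s ^ (2 * m) := by
  have hinv : quarterTurn (Φ (dihedralInvariants m (X 0) (X 1) 1)) =
      Φ (dihedralInvariants m (X 0) (X 1) 1) := by
    rw [← quotientComorphism_gen, hΦ]
    exact DFunLike.congr_fun (quarterTurn_comp_quotientComorphism m) _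
  have hm2 : 2 * m ≠ 0 := by omega
  have := congrArg (eval ![1, 0]) hinv
  rcases h with ⟨h₀, h₁⟩ | ⟨h₀, h₁⟩
  · symm
    simpa [dihedralInvariants, h₀, h₁, quarterTurn, smul_pow, hm2] using this
  · simpa [dihedralInvariants, h₀, h₁, quarterTurn, smul_pow, hm2] using this

end Lift

/-- For n ≥ 5, every ℂ-algebra automorphism of A is diagonal of the stated form. -/
theorem dn_autos_diagonal (n : ℕ) (hn : 5 ≤ n) (φ : Adn n ≃ₐ[ℂ] Adn n) :
    ∃ (l ε ε' : ℂ), l ≠ 0 ∧ (ε = 1 ∨ ε = -1) ∧ (ε' = 1 ∨ ε' = -1) ∧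
      φ (Ideal.Quotient.mk (Idn n) (X 0)) =
        (l ^ 2) • Ideal.Quotient.mk (Idn n) (X 0) ∧
      φ (Ideal.Quotient.mk (Idn n) (X 1)) =
        (ε * l ^ (n - 2)) • Ideal.Quotient.mk (Idn n) (X 1) ∧
      φ (Ideal.Quotient.mk (Idn n) (X 2)) =
        (ε' * l ^ (n - 1)) • Ideal.Quotient.mk (Idn n) (X 2) := by
  obtain ⟨m, rfl⟩ : ∃ m, n = m + 2 := ⟨n - 2, by omega⟩
  have hm : 0 < m := by omega
  rw [show m + 2 - 2 = m by omega, show m + 2 - 1 = m + 1 by omega]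
  obtain ⟨Φ, hΦ⟩ := exists_lift_equiv hm φ
  obtain ⟨r, s, hr, hs, h⟩ := isMonomial_lift (by omega) hΦ
  have hrs := pow_eq_pow_of_lift hm hΦ h
  have hε : ((r / s) ^ m) ^ 2 = 1 := by
    rw [← pow_mul, mul_comm, div_pow, hrs, div_self (pow_ne_zero _ hs)]
  have hl : (r / s) ^ m * (r * s) ^ m = s ^ (2 * m) := by
    rw [← mul_pow, ← hrs, pow_mul]
    congr 1
    field_simp
  have hgen : ∀ (c : ℂ) (i : Fin 3), dihedralInvariants m (Φ (X 0)) (Φ (X 1)) i =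
      c • dihedralInvariants m (X 0) (X 1) i → φ (Adn.gen (m + 2) i) = c • Adn.gen (m + 2) i := by
    intro c i hi
    apply quotientComorphism_injective hm
    rw [map_smul, quotientComorphism_gen, ← hi, ← hΦ, quotientComorphism_gen]
    exact map_dihedralInvariants Φ.toAlgHom m _ _ i
  have hl' : (r / s) ^ m * (r * s) ^ (m + 1) = s ^ (2 * m) * (r * s) := by
    rw [pow_succ, ← mul_assoc, hl]
  have hC : (C r : Plane) ^ (2 * m) = C s ^ (2 * m) := by rw [← C_pow, hrs, C_pow]
  have hsign := sq_eq_one_iff.mp hε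
  rcases h with ⟨h₀, h₁⟩ | ⟨h₀, h₁⟩
  all_goals
    replace h₀ : Φ (X 0) = _ := h₀
    replace h₁ : Φ (X 1) = _ := h₁
  · refine ⟨r * s, (r / s) ^ m, (r / s) ^ m, mul_ne_zero hr hs, hsign, hsign,
      hgen _ 0 ?_, hgen _ 1 ?_, hgen _ 2 ?_⟩
    all_goals
      simp only [dihedralInvariants, h₀, h₁, hl, hl', Matrix.cons_val, smul_eq_C_mul]
      simp only [C_mul, C_pow, mul_pow, hC]
      ring
  · refine ⟨r * s, (r / s) ^ m, -(r / s) ^ m, mul_ne_zero hr hs, hsign,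
      by rwa [neg_eq_iff_eq_neg, neg_inj, or_comm], hgen _ 0 ?_, hgen _ 1 ?_, hgen _ 2 ?_⟩
    all_goals
      simp only [dihedralInvariants, h₀, h₁, hl, hl', neg_mul, Matrix.cons_val, smul_eq_C_mul]
      simp only [C_mul, C_pow, C_neg, mul_pow, hC]
      ring

end
end
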